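/- arXiv:1502.02466 — 7 statements merged into one kernel-verified Lean document; each statement's English description precedes it below -/
import Mathlib

section
/- Let N be a positive integer and for each positive divisor δ of N let r_δ be an integer such that (N/24)·∑_{δ∣N} δ·r_δ ∈ ℤ, (N/24)·∑_{δ∣N} r_δ/δ ∈ ℤ, and ∑_{δ∣N} r_δ is even. Set k = (1/2)·∑_{δ∣N} r_δ ∈ ℤ and f(τ) = ∏_{δ∣N} η(δτ)^{r_δ} for τ in the upper half-plane ℍ. Then for every matrix M = ((a,b),(c,d)) ∈ Γ₁(N) and every τ ∈ ℍ one has f((aτ+b)/(cτ+d)) = e(b·(1/24)·∑_{δ∣N} δ·r_δ)·(cτ+d)^k·f(τ). -/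
open Complex UpperHalfPlane CongruenceSubgroup
open scoped MatrixGroups

noncomputable section

/-- `e(z) = exp(2πiz)`. -/
def eFun (z : ℂ) : ℂ := Complex.exp (2 * Real.pi * Complex.I * z)

/-- The Dedekind eta function `η(τ) = e(τ/24) ∏_{n=1}^∞ (1 - e(nτ))`. -/
def DedekindEta (z : ℂ) : ℂ :=
  eFun (z / 24) * ∏' n : ℕ, (1 - eFun ((n + 1) * z))

/-- The `24`-th root of unity `e(n/24)`. -/
def rootUnity (n : ℤ) : ℂ := eFun (n / 24)

lemma eFun_add (x y : ℂ) : eFun (x + y) = eFun x * eFun y := by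
  simp only [eFun, ← Complex.exp_add]; ring_nf

lemma eFun_intCast (n : ℤ) : eFun n = 1 := by
  rw [eFun, Complex.exp_eq_one_iff]
  exact ⟨n, by ring⟩

lemma rootUnity_add (m n : ℤ) : rootUnity (m + n) = rootUnity m * rootUnity n := by
  rw [rootUnity, rootUnity, rootUnity, ← eFun_add]
  push_cast
  ring_nf

lemma rootUnity_eq_one {n : ℤ} (h : 24 ∣ n) : rootUnity n = 1 := by
  obtain ⟨m, rfl⟩ := h
  rw [rootUnity, ← eFun_intCast m]
  push_cast
  ring_nf

lemma rootUnity_congr {m n : ℤ} (h : 24 ∣ m - n) : rootUnity m = rootUnity n := by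
  rw [← sub_add_cancel m n, rootUnity_add, rootUnity_eq_one h, one_mul]

lemma rootUnity_zpow (n m : ℤ) : rootUnity n ^ m = rootUnity (m * n) := by
  rw [rootUnity, rootUnity, eFun, eFun, ← Complex.exp_int_mul]
  push_cast
  ring_nf

lemma rootUnity_sum {ι : Type*} (s : Finset ι) (f : ι → ℤ) :
    rootUnity (∑ i ∈ s, f i) = ∏ i ∈ s, rootUnity (f i) := by
  classical
  induction s using Finset.induction_on with
  | empty => simp [rootUnity_eq_one]
  | insert a s ha ih => rw [Finset.sum_insert ha, Finset.prod_insert ha, rootUnity_add, ih]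

lemma rootUnity_twelve : rootUnity 12 = -1 := by
  rw [rootUnity, eFun, ← Complex.exp_pi_mul_I]
  push_cast
  ring_nf

lemma rootUnity_twelve_mul_nat (n : ℕ) : rootUnity (12 * n) = (-1) ^ n := by
  rw [← rootUnity_twelve, ← zpow_natCast, rootUnity_zpow, mul_comm]

lemma rootUnity_six : rootUnity 6 = Complex.I := by
  rw [rootUnity, eFun]
  convert Complex.exp_pi_div_two_mul_I using 2
  push_cast
  ring

/-! ### The principal square root -/

lemma sqrt_sq (z : ℂ) : sqrt z ^ 2 = z := by
  simp [sqrt, ← Complex.cpow_nat_mul]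

lemma eq_sqrt_or_eq_neg_sqrt {s w : ℂ} (h : s ^ 2 = w) : s = sqrt w ∨ s = -sqrt w :=
  sq_eq_sq_iff_eq_or_eq_neg.mp (h.trans (sqrt_sq w).symm)

lemma re_sqrt_nonneg (z : ℂ) : 0 ≤ (sqrt z).re := by
  rcases eq_or_ne z 0 with rfl | hz
  · simp [sqrt]
  · rw [sqrt_eq_exp hz, Complex.exp_re]
    refine mul_nonneg (Real.exp_pos _).le (Real.cos_nonneg_of_mem_Icc ⟨?_, ?_⟩)
    · have := Complex.neg_pi_lt_arg z
      simp [Complex.log_im]; linarith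
    · have := Complex.arg_le_pi z
      simp [Complex.log_im]; linarith

lemma two_mul_re_mul_im_sqrt (z : ℂ) : 2 * ((sqrt z).re * (sqrt z).im) = z.im := by
  conv_rhs => rw [← sqrt_sq z, sq, Complex.mul_im]
  ring

lemma re_sqrt_pos_of_im_ne_zero {z : ℂ} (hz : z.im ≠ 0) : 0 < (sqrt z).re := by
  refine (re_sqrt_nonneg z).lt_of_ne fun h ↦ hz ?_
  rw [← two_mul_re_mul_im_sqrt, ← h]; ring

lemma im_sqrt_pos {z : ℂ} (hz : 0 < z.im) : 0 < (sqrt z).im := by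
  have := two_mul_re_mul_im_sqrt z
  have h := re_sqrt_pos_of_im_ne_zero hz.ne'
  exact pos_of_mul_pos_right (by linarith) h.le

lemma im_sqrt_neg {z : ℂ} (hz : z.im < 0) : (sqrt z).im < 0 := by
  have := two_mul_re_mul_im_sqrt z
  have h := re_sqrt_pos_of_im_ne_zero hz.ne
  by_contra! h'
  nlinarith [mul_nonneg h.le h']

lemma eq_sqrt_of_re_pos {s w : ℂ} (h : s ^ 2 = w) (hs : 0 < s.re) : s = sqrt w := by
  rcases eq_sqrt_or_eq_neg_sqrt h with h | h
  · exact h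
  · have := re_sqrt_nonneg w
    rw [h, Complex.neg_re] at hs
    linarith

lemma eq_sqrt_of_im_pos {s w : ℂ} (h : s ^ 2 = w) (hw : 0 < w.im) (hs : 0 < s.im) :
    s = sqrt w := by
  rcases eq_sqrt_or_eq_neg_sqrt h with h | h
  · exact h
  · have := im_sqrt_pos hw
    rw [h, Complex.neg_im] at hs
    linarith

lemma sqrt_mul_sqrt_of_im_neg {x y : ℂ} (hx : x.im < 0) (hy : 0 < y.im) :
    sqrt x * sqrt y = sqrt (x * y) := by
  refine eq_sqrt_of_re_pos (by rw [mul_pow, sqrt_sq, sqrt_sq]) ?_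
  rw [Complex.mul_re]
  have := mul_pos (re_sqrt_pos_of_im_ne_zero hx.ne) (re_sqrt_pos_of_im_ne_zero hy.ne')
  have := mul_neg_of_neg_of_pos (im_sqrt_neg hx) (im_sqrt_pos hy)
  linarith

lemma sqrt_mul_sqrt_of_im_pos {x y : ℂ} (hx : 0 < x.im) (hy : 0 < y.im) (h : 0 < (x * y).im) :
    sqrt x * sqrt y = sqrt (x * y) := by
  refine eq_sqrt_of_im_pos (by rw [mul_pow, sqrt_sq, sqrt_sq]) h ?_
  rw [Complex.mul_im]
  have := mul_pos (re_sqrt_pos_of_im_ne_zero hx.ne') (im_sqrt_pos hy)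
  have := mul_pos (im_sqrt_pos hx) (re_sqrt_pos_of_im_ne_zero hy.ne')
  linarith

lemma sqrt_mul_sqrt_of_pos {x : ℝ} {y : ℂ} (hx : 0 < x) (hy : 0 < y.im) :
    sqrt x * sqrt y = sqrt (x * y) := by
  refine eq_sqrt_of_im_pos (by rw [mul_pow, sqrt_sq, sqrt_sq])
    (by simpa using mul_pos hx hy) ?_
  have h : ((Real.sqrt x : ℝ) : ℂ) = sqrt x :=
    eq_sqrt_of_re_pos (by rw [← Complex.ofReal_pow, Real.sq_sqrt hx.le])
      (by simpa using Real.sqrt_pos.2 hx)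
  rw [← h, Complex.im_ofReal_mul]
  exact mul_pos (Real.sqrt_pos.2 hx) (im_sqrt_pos hy)

lemma sqrt_neg_of_im_neg {z : ℂ} (hz : z.im < 0) : sqrt (-z) = Complex.I * sqrt z := by
  refine (eq_sqrt_of_re_pos (by rw [mul_pow, sqrt_sq, Complex.I_sq]; ring) ?_).symm
  simpa using im_sqrt_neg hz

lemma sqrt_neg_of_im_pos {z : ℂ} (hz : 0 < z.im) : sqrt (-z) = -(Complex.I * sqrt z) := by
  refine (eq_sqrt_of_re_pos (by rw [neg_sq, mul_pow, sqrt_sq, Complex.I_sq]; ring) ?_).symm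
  simpa using im_sqrt_pos hz

lemma sqrt_I_eq_rootUnity : sqrt Complex.I = rootUnity 3 := by
  refine (eq_sqrt_of_re_pos ?_ ?_).symm
  · rw [← rootUnity_six, ← zpow_natCast, rootUnity_zpow]; norm_num
  · have e : 2 * (Real.pi : ℂ) * Complex.I * ((3 : ℤ) / 24) = (Real.pi / 4 : ℝ) * Complex.I := by
      push_cast; ring
    rw [rootUnity, eFun, e, Complex.exp_ofReal_mul_I_re, Real.cos_pi_div_four]
    positivity

/-! ### Translation and inversion of `η` -/

lemma dedekindEta_eq_eta (z : ℂ) : DedekindEta z = ModularForm.eta z := by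
  simp only [DedekindEta, ModularForm.eta, ModularForm.eta_q_eq_cexp, eFun,
    Function.Periodic.qParam]
  congr 1
  · push_cast; ring_nf
  · simp only [mul_assoc]

lemma dedekindEta_add_int (z : ℂ) (n : ℤ) :
    DedekindEta (z + n) = rootUnity n * DedekindEta z := by
  have h (m : ℕ) : eFun ((m + 1) * (z + n)) = eFun ((m + 1) * z) := by
    rw [mul_add, eFun_add, show ((m : ℂ) + 1) * n = (((m + 1) * n : ℤ) : ℂ) by push_cast; ring,
      eFun_intCast, mul_one]
  simp only [DedekindEta, h, add_div, eFun_add, rootUnity]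
  ring

lemma dedekindEta_neg_inv {z : ℂ} (hz : 0 < z.im) :
    DedekindEta (-1 / z) = rootUnity (-3) * sqrt z * DedekindEta z := by
  have h := ModularForm.eta_comp_eq_csqrt_I_inv hz
  simp only [Function.comp_apply, Pi.smul_apply, Pi.mul_apply, smul_eq_mul] at h
  rw [dedekindEta_eq_eta, dedekindEta_eq_eta, h, sqrt_I_eq_rootUnity, ← zpow_neg_one,
    rootUnity_zpow]
  norm_num [mul_assoc]

lemma im_neg_one_div_pos {z : ℂ} (hz : 0 < z.im) : 0 < (-1 / z).im := by
  rw [neg_div, one_div, Complex.neg_im, Complex.inv_im, neg_div, neg_neg]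
  exact div_pos hz (Complex.normSq_pos.2 (by rintro rfl; simp at hz))

lemma dedekindEta_div_add_one {z : ℂ} (hz : 0 < z.im) :
    DedekindEta (z / (z + 1)) = rootUnity (-1) * sqrt (z + 1) * DedekindEta z := by
  have hz0 : z ≠ 0 := by rintro rfl; simp at hz
  have hz1 : 0 < (z + 1).im := by simpa using hz
  have hz10 : z + 1 ≠ 0 := by intro h; simp [h] at hz1
  have hw : 0 < (-1 / z + (-1 : ℤ)).im := by simpa using im_neg_one_div_pos hz
  have hw0 : -1 / z + (-1 : ℤ) ≠ 0 := by intro h; rw [h] at hw; simp at hw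
  have e : z / (z + 1) = -1 / (-1 / z + (-1 : ℤ)) := by
    rw [div_eq_div_iff hz10 hw0]; push_cast; field_simp; ring
  have hp : (-1 / z + (-1 : ℤ)) * z = -(z + 1) := by push_cast; field_simp; ring
  have hs : sqrt (-1 / z + (-1 : ℤ)) * sqrt z = Complex.I * sqrt (z + 1) := by
    rcases eq_sqrt_or_eq_neg_sqrt (s := sqrt (-1 / z + (-1 : ℤ)) * sqrt z) (w := -(z + 1))
      (by rw [mul_pow, sqrt_sq, sqrt_sq, hp]) with h | h
    · have h1 : 0 < (sqrt (-1 / z + (-1 : ℤ)) * sqrt z).im := by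
        rw [Complex.mul_im]
        have := mul_pos (re_sqrt_pos_of_im_ne_zero hw.ne') (im_sqrt_pos hz)
        have := mul_pos (im_sqrt_pos hw) (re_sqrt_pos_of_im_ne_zero hz.ne')
        linarith
      have h2 : (sqrt (-(z + 1))).im < 0 := im_sqrt_neg (by simpa using hz)
      rw [h] at h1
      linarith
    · rw [h, sqrt_neg_of_im_pos hz1, neg_neg]
  have hr : rootUnity (-3) * rootUnity (-1) * rootUnity (-3) * Complex.I =
      rootUnity (-1) := by
    rw [← rootUnity_six]; simp only [← rootUnity_add]; norm_num
  rw [e, dedekindEta_neg_inv hw, dedekindEta_add_int, dedekindEta_neg_inv hz]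
  linear_combination rootUnity (-3) * rootUnity (-1) * rootUnity (-3) * DedekindEta z * hs +
    sqrt (z + 1) * DedekindEta z * hr

/-! ### The multiplier system of `η` -/

/-- The exponent in the multiplier of `η` at `((a, b), (c, d))` for odd `d > 0`. -/
def etaExponent (a b c d : ℤ) : ℤ :=
  (a + d) * c - b * d * (c ^ 2 - 1) + 3 * d - 3 - 3 * c * d

/-- The transformation formula of `η` for all matrices in `SL₂(ℤ)` with bottom row `(c, d)`. -/
def EtaTransforms (c : ℤ) (d : ℕ) : Prop :=
  ∀ a b : ℤ, a * d - b * c = 1 → ∀ z : ℂ, 0 < z.im →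
    DedekindEta ((a * z + b) / (c * z + d)) =
      jacobiSym c d * rootUnity (etaExponent a b c d) * sqrt (c * z + d) * DedekindEta z

lemma ofReal_im_mul_add (c : ℤ) (d : ℕ) (z : ℂ) : ((c : ℂ) * z + d).im = c * z.im := by
  simp

lemma mul_add_ne_zero_of_pos (c : ℤ) {d : ℕ} (hd : 0 < d) {z : ℂ} (hz : 0 < z.im) :
    (c : ℂ) * z + d ≠ 0 := by
  intro h
  have him := congrArg Complex.im h
  rw [ofReal_im_mul_add, Complex.zero_im, mul_eq_zero, or_iff_left hz.ne'] at him
  have hc : c = 0 := by exact_mod_cast him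
  simp [hc, hd.ne'] at h

lemma im_div_add_one_pos {z : ℂ} (hz : 0 < z.im) : 0 < (z / (z + 1)).im := by
  have hz0 : z ≠ 0 := by rintro rfl; simp at hz
  have hz1 : z + 1 ≠ 0 := by intro h; simpa [hz.ne'] using congrArg Complex.im h
  have hw : 0 < (-1 / z + (-1 : ℤ)).im := by simpa using im_neg_one_div_pos hz
  have hw0 : -1 / z + (-1 : ℤ) ≠ 0 := by intro h; rw [h] at hw; simp at hw
  have e : z / (z + 1) = -1 / (-1 / z + (-1 : ℤ)) := by
    rw [div_eq_div_iff hz1 hw0]; push_cast; field_simp; ring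
  rw [e]
  exact im_neg_one_div_pos hw

lemma im_div_one_sub_pos {z : ℂ} (hz : 0 < z.im) : 0 < (z / (1 - z)).im := by
  have hz0 : z ≠ 0 := by rintro rfl; simp at hz
  have hz1 : 1 - z ≠ 0 := by intro h; simpa [hz.ne'] using congrArg Complex.im h
  have hw : 0 < (-1 / z + (1 : ℤ)).im := by simpa using im_neg_one_div_pos hz
  have hw0 : -1 / z + (1 : ℤ) ≠ 0 := by intro h; rw [h] at hw; simp at hw
  have e : z / (1 - z) = -1 / (-1 / z + (1 : ℤ)) := by
    rw [div_eq_div_iff hz1 hw0]; push_cast; field_simp; ring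
  rw [e]
  exact im_neg_one_div_pos hw

lemma sqrt_mul_sqrt_add_one (c : ℤ) {d : ℕ} (hd : 0 < d) {w : ℂ} (hw : 0 < w.im) :
    sqrt (c * (w / (w + 1)) + d) * sqrt (w + 1) = sqrt (((c + d : ℤ) : ℂ) * w + d) := by
  have hw1 : 0 < (w + 1).im := by simpa using hw
  have hw10 : w + 1 ≠ 0 := by intro h; simp [h] at hw1
  have hL := im_div_add_one_pos hw
  have e : (c * (w / (w + 1)) + d) * (w + 1) = ((c + d : ℤ) : ℂ) * w + d := by
    push_cast; field_simp; ring
  have him : ((c : ℂ) * (w / (w + 1)) + d).im = c * (w / (w + 1)).im := ofReal_im_mul_add _ _ _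
  rcases lt_trichotomy c 0 with hc | rfl | hc
  · rw [← e]
    refine sqrt_mul_sqrt_of_im_neg ?_ hw1
    rw [him]
    exact mul_neg_of_neg_of_pos (by exact_mod_cast hc) hL
  · rw [← e]
    simpa using sqrt_mul_sqrt_of_pos (x := d) (by exact_mod_cast hd) hw1
  · rw [← e]
    refine sqrt_mul_sqrt_of_im_pos ?_ hw1 ?_
    · rw [him]
      exact mul_pos (by exact_mod_cast hc) hL
    · rw [e, ofReal_im_mul_add]
      exact mul_pos (by exact_mod_cast (by positivity : 0 < c + d)) hw

lemma twentyFour_dvd_mul_sq_sub_one {d : ℤ} (hd : Odd d) : 24 ∣ d * (d ^ 2 - 1) := by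
  obtain ⟨m, rfl⟩ := hd
  have h6 : ∀ x : ZMod 6, (2 * x + 1) * (x * (x + 1)) = 0 := by decide
  have h : (6 : ℤ) ∣ (2 * m + 1) * (m * (m + 1)) :=
    (ZMod.intCast_zmod_eq_zero_iff_dvd _ 6).1 (by push_cast; exact h6 m)
  have e : (2 * m + 1) * ((2 * m + 1) ^ 2 - 1) = 4 * ((2 * m + 1) * (m * (m + 1))) := by ring
  rw [e]
  exact mul_dvd_mul_left 4 h

lemma rootUnity_etaExponent_add {a b c d : ℤ} (hd : Odd d) (h : a * d - b * c = 1) :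
    rootUnity (etaExponent a b c d) * rootUnity (-1) =
      rootUnity (etaExponent (a + b) b (c + d) d) := by
  rw [← rootUnity_add]
  refine rootUnity_congr ?_
  have e : etaExponent a b c d + -1 - etaExponent (a + b) b (c + d) d =
      (2 * a + b) * (d * (d ^ 2 - 1)) := by
    have : b * c = a * d - 1 := by linarith
    simp only [etaExponent]
    linear_combination (2 * d ^ 2 - 1) * this
  rw [e]
  exact (twentyFour_dvd_mul_sq_sub_one hd).mul_left _

lemma jacobiSym_add_self (c : ℤ) (d : ℕ) : jacobiSym (c + d) d = jacobiSym c d :=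
  jacobiSym.mod_left' (by simp)

lemma etaTransforms_add_iff (c : ℤ) {d : ℕ} (hd : Odd d) :
    EtaTransforms (c + d) d ↔ EtaTransforms c d := by
  have hd' : Odd (d : ℤ) := by exact_mod_cast hd
  have key (a b : ℤ) (h : a * d - b * c = 1) (w : ℂ) (hw : 0 < w.im) :
      (DedekindEta (((a + b : ℤ) * w + b) / ((c + d : ℤ) * w + d)) =
        jacobiSym (c + d) d * rootUnity (etaExponent (a + b) b (c + d) d) *
          sqrt ((c + d : ℤ) * w + d) * DedekindEta w) ↔
      (DedekindEta ((a * (w / (w + 1)) + b) / (c * (w / (w + 1)) + d)) =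
        jacobiSym c d * rootUnity (etaExponent a b c d) *
          sqrt (c * (w / (w + 1)) + d) * DedekindEta (w / (w + 1))) := by
    have hw1 : w + 1 ≠ 0 := by intro h; simpa [hw.ne'] using congrArg Complex.im h
    have e : (a * (w / (w + 1)) + b) / (c * (w / (w + 1)) + d) =
        ((a + b : ℤ) * w + b) / ((c + d : ℤ) * w + d) := by
      rw [div_eq_div_iff (mul_add_ne_zero_of_pos c hd.pos (im_div_add_one_pos hw))
        (mul_add_ne_zero_of_pos _ hd.pos hw)]
      push_cast; field_simp; ring
    rw [e, jacobiSym_add_self, dedekindEta_div_add_one hw, ← rootUnity_etaExponent_add hd' h,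
      ← sqrt_mul_sqrt_add_one c hd.pos hw]
    ring_nf
  constructor
  · intro H a b h z hz
    have hz1 : 1 - z ≠ 0 := by intro h; simpa [hz.ne'] using congrArg Complex.im h
    have hw := im_div_one_sub_pos hz
    have e : z / (1 - z) / (z / (1 - z) + 1) = z := by
      have : z / (1 - z) + 1 = 1 / (1 - z) := by field_simp; ring
      rw [this]; field_simp
    have := (key a b h _ hw).1 (H (a + b) b (by linear_combination h) _ hw)
    rwa [e] at this
  · intro H a b h w hw
    have h' : (a - b) * d - b * c = 1 := by linear_combination h
    have := (key (a - b) b h' w hw).2 (H (a - b) b h' _ (im_div_add_one_pos hw))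
    rwa [sub_add_cancel] at this

lemma etaTransforms_add_mul_iff (c : ℤ) {d : ℕ} (hd : Odd d) (j : ℤ) :
    EtaTransforms (c + j * d) d ↔ EtaTransforms c d := by
  induction j using Int.induction_on with
  | zero => simp
  | succ i ih => rw [← ih, ← etaTransforms_add_iff (c + i * d) hd]; ring_nf
  | pred i ih => rw [← ih, ← etaTransforms_add_iff (c + (-i - 1) * d) hd]; ring_nf

lemma etaTransforms_one (c : ℤ) : EtaTransforms c 1 := by
  have h := etaTransforms_add_mul_iff 0 odd_one c
  rw [show (0 : ℤ) + c * (1 : ℕ) = c by simp] at h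
  rw [h]
  intro a b hab z _
  obtain rfl : a = 1 := by simpa using hab
  simp [dedekindEta_add_int, etaExponent, sqrt]

lemma rootUnity_qrSign {m n : ℕ} (hm : Odd m) (hn : Odd n) :
    rootUnity (3 * (m - 1) * (n - 1)) = (-1) ^ (m / 2 * (n / 2)) := by
  rw [← rootUnity_twelve_mul_nat]
  obtain ⟨k, rfl⟩ := hm
  obtain ⟨l, rfl⟩ := hn
  rw [show (2 * k + 1) / 2 = k by omega, show (2 * l + 1) / 2 = l by omega]
  push_cast
  ring_nf

lemma jacobiSym_reciprocity {m n : ℕ} (hm : Odd m) (hn : Odd n) :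
    (jacobiSym m n : ℂ) = rootUnity (3 * (m - 1) * (n - 1)) * jacobiSym n m := by
  rw [jacobiSym.quadratic_reciprocity hm hn, rootUnity_qrSign hm hn]
  push_cast
  rfl

lemma jacobiSym_neg_left (a : ℤ) {n : ℕ} (hn : Odd n) :
    (jacobiSym (-a) n : ℂ) = rootUnity (6 * (n - 1)) * jacobiSym a n := by
  rw [jacobiSym.neg a hn, ZMod.χ₄_eq_neg_one_pow (Nat.odd_iff.1 hn)]
  push_cast
  rw [← rootUnity_twelve_mul_nat]
  obtain ⟨k, rfl⟩ := hn
  rw [show (2 * k + 1) / 2 = k by omega]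
  push_cast
  ring_nf

lemma etaTransforms_of_swap_pos {c d : ℕ} (hc : Odd c) (hd : Odd d)
    (h : EtaTransforms (-d) c) : EtaTransforms c d := by
  intro a b hab z hz
  have hz0 : z ≠ 0 := by rintro rfl; simp at hz
  have hw := im_neg_one_div_pos hz
  have hH := h (-b) a (by linear_combination hab) _ hw
  have hcz := mul_add_ne_zero_of_pos c hd.pos hz
  have e : (((-b : ℤ) : ℂ) * (-1 / z) + a) / (((-d : ℤ) : ℂ) * (-1 / z) + c) =
      (a * z + b) / ((c : ℤ) * z + d) := by
    rw [div_eq_div_iff (mul_add_ne_zero_of_pos _ hc.pos hw) hcz]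
    push_cast; field_simp; ring
  have hp : (((-d : ℤ) : ℂ) * (-1 / z) + c) * z = (c : ℤ) * z + d := by
    push_cast; field_simp; ring
  have hs : sqrt (((-d : ℤ) : ℂ) * (-1 / z) + c) * sqrt z = sqrt ((c : ℤ) * z + d) := by
    rw [← hp]
    refine sqrt_mul_sqrt_of_im_neg ?_ hz
    rw [ofReal_im_mul_add]
    exact mul_neg_of_neg_of_pos (by exact_mod_cast (by simpa using hd.pos)) hw
  have hr : rootUnity (etaExponent (-b) a (-d) c) * rootUnity (6 * (c - 1)) * rootUnity (-3) =
      rootUnity (3 * (c - 1) * (d - 1)) * rootUnity (etaExponent a b c d) := by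
    simp only [← rootUnity_add]
    refine rootUnity_congr ?_
    obtain ⟨k, hk⟩ := hc
    have hk' : (c : ℤ) = 2 * k + 1 := by exact_mod_cast hk
    refine ⟨k, ?_⟩
    simp only [etaExponent]
    linear_combination (-c * d : ℤ) * hab + 12 * hk'
  rw [← e, hH, dedekindEta_neg_inv hz, ← hs, jacobiSym_neg_left _ hc, jacobiSym_reciprocity hc hd]
  linear_combination (jacobiSym d c * sqrt (((-d : ℤ) : ℂ) * (-1 / z) + c) * sqrt z *
    DedekindEta z) * hr

lemma etaTransforms_of_swap_neg {c d : ℕ} (hc : Odd c) (hd : Odd d)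
    (h : EtaTransforms d c) : EtaTransforms (-c) d := by
  intro a b hab z hz
  have hz0 : z ≠ 0 := by rintro rfl; simp at hz
  have hw := im_neg_one_div_pos hz
  have hH := h b (-a) (by linear_combination hab) _ hw
  have hcz := mul_add_ne_zero_of_pos (-c) hd.pos hz
  have e : ((b : ℂ) * (-1 / z) + (-a : ℤ)) / (((d : ℤ) : ℂ) * (-1 / z) + c) =
      (a * z + b) / ((-c : ℤ) * z + d) := by
    rw [div_eq_div_iff (mul_add_ne_zero_of_pos _ hc.pos hw) hcz]
    push_cast; field_simp; ring
  have hp : (((d : ℤ) : ℂ) * (-1 / z) + c) * z = -((-c : ℤ) * z + d) := by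
    push_cast; field_simp; ring
  have him : (((-c : ℤ) : ℂ) * z + d).im < 0 := by
    rw [ofReal_im_mul_add]
    exact mul_neg_of_neg_of_pos (by exact_mod_cast (by simpa using hc.pos)) hz
  have hs : sqrt (((d : ℤ) : ℂ) * (-1 / z) + c) * sqrt z =
      Complex.I * sqrt ((-c : ℤ) * z + d) := by
    rw [← sqrt_neg_of_im_neg him, ← hp]
    refine sqrt_mul_sqrt_of_im_pos ?_ hz ?_
    · rw [ofReal_im_mul_add]
      exact mul_pos (by exact_mod_cast hd.pos) hw
    · rw [hp, Complex.neg_im]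
      linarith
  have hr : rootUnity (etaExponent b (-a) d c) * rootUnity (-3) * Complex.I =
      rootUnity (6 * (d - 1)) * rootUnity (3 * (c - 1) * (d - 1)) *
        rootUnity (etaExponent a b (-c) d) := by
    rw [← rootUnity_six]
    simp only [← rootUnity_add]
    refine rootUnity_congr ?_
    obtain ⟨k, hk⟩ := hc
    obtain ⟨l, hl⟩ := hd
    have e2 : (6 * (c + 1) * (d - 1) : ℤ) = 24 * ((k + 1) * l) := by rw [hk, hl]; push_cast; ring
    refine ⟨-((k + 1) * l), ?_⟩
    simp only [etaExponent]
    linear_combination (c * d : ℤ) * hab - e2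
  rw [← e, hH, dedekindEta_neg_inv hz, jacobiSym_neg_left _ hd, jacobiSym_reciprocity hc hd]
  linear_combination (jacobiSym d c * rootUnity (etaExponent b (-a) d c) * rootUnity (-3) *
    DedekindEta z) * hs + (jacobiSym d c * sqrt ((-c : ℤ) * z + d) * DedekindEta z) * hr

lemma etaTransforms_of_odd {d : ℕ} (hd : Odd d) (c : ℤ) : EtaTransforms c d := by
  induction d using Nat.strong_induction_on generalizing c with
  | _ d ih =>
    rcases eq_or_ne d 1 with rfl | hd1
    · exact etaTransforms_one c
    have hd0 : (0 : ℤ) < d := by exact_mod_cast hd.pos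
    have h0 := Int.emod_nonneg c hd0.ne'
    have h1 := Int.emod_lt_of_pos c hd0
    have h2 := Int.emod_add_mul_ediv c d
    have hd' : Odd (d : ℤ) := by exact_mod_cast hd
    rcases Int.even_or_odd (c % d) with he | ho
    · obtain ⟨n, hn⟩ : ∃ n : ℕ, d - c % d = n := Int.eq_ofNat_of_zero_le (by linarith)
      have hno : Odd n := by
        have : Odd (d - c % d) := hd'.sub_even he
        rw [hn] at this
        exact_mod_cast this
      have key : EtaTransforms (-n) d := by
        rcases h0.eq_or_lt with h0 | h0
        · intro a b hab
          exfalso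
          have : (d : ℤ) ∣ 1 := by
            rw [← hab, ← hn, ← h0, sub_zero]
            exact ⟨a + b, by ring⟩
          exact hd1 (by exact_mod_cast Int.eq_one_of_dvd_one hd0.le this)
        · exact etaTransforms_of_swap_neg hno hd (ih n (by omega) hno d)
      rw [← etaTransforms_add_mul_iff _ hd (-(c / d) - 1)]
      convert key using 1
      linarith
    · obtain ⟨n, hn⟩ := Int.eq_ofNat_of_zero_le h0
      rw [hn] at ho
      have hno : Odd n := by exact_mod_cast ho
      rw [← etaTransforms_add_mul_iff _ hd (-(c / d))]
      convert etaTransforms_of_swap_pos hno hd (ih n (by omega) hno (-d)) using 1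
      linarith

/-! ### Congruences for the exponents -/

lemma two_pow_dvd_of_dvd_odd_mul {n x : ℤ} (t : ℕ) (hn : Odd n) (h : 2 ^ t ∣ n * x) :
    2 ^ t ∣ x :=
  (IsCoprime.pow_left (Int.isCoprime_two_left.2 hn)).dvd_of_dvd_mul_left h

section Congruences

variable {δ e v u n : ℕ}

lemma eight_dvd_of_mul_eq_two_mul (hn : Odd n) (he : δ * e = 2 * n) (hu : Odd u)
    (hδ : δ = 2 ^ v * u) : (8 : ℤ) ∣ δ + n * e - 3 * u ∧ (2 : ℤ) ∣ v - e := by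
  rcases v with _ | _ | v
  · obtain rfl : δ = u := by simpa using hδ
    obtain ⟨f, rfl⟩ : 2 ∣ e := (Nat.Coprime.dvd_of_dvd_mul_left
      (Nat.coprime_two_left.2 hu) ⟨n, he⟩)
    obtain rfl : n = δ * f := by linarith
    have hf : Odd (f : ℤ) := by exact_mod_cast (Nat.odd_mul.1 hn).2
    refine ⟨?_, ⟨-f, by push_cast; ring⟩⟩
    have e : (δ : ℤ) + (δ * f : ℕ) * (2 * f : ℕ) - 3 * δ = 2 * δ * (f ^ 2 - 1) := by
      push_cast; ring
    exact e ▸ (Int.eight_dvd_sq_sub_one_of_odd hf).mul_left _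
  · obtain rfl : n = u * e := by rw [hδ, zero_add, pow_one] at he; linarith
    obtain ⟨f, hf⟩ := (Nat.odd_mul.1 hn).2
    have hf' : Odd (e : ℤ) := ⟨f, by exact_mod_cast hf⟩
    refine ⟨?_, ⟨-f, by rw [hf]; push_cast; ring⟩⟩
    have h : (δ : ℤ) + (u * e : ℕ) * e - 3 * u = u * (e ^ 2 - 1) := by
      rw [hδ]; push_cast; ring
    exact h ▸ (Int.eight_dvd_sq_sub_one_of_odd hf').mul_left _
  · exfalso
    have : n = 2 * (2 ^ v * u * e) := by rw [hδ, pow_succ, pow_succ] at he; linarith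
    exact Nat.not_odd_iff_even.2 ⟨_, this.trans (two_mul _)⟩ hn

lemma two_dvd_of_mul_eq_four_mul (hn : Odd n) (he : δ * e = 4 * n) (hu : Odd u)
    (hδ : δ = 2 ^ v * u) : (2 : ℤ) ∣ v + δ + e + 1 := by
  obtain ⟨w, hw⟩ := hu
  rcases v with _ | _ | _ | v
  · obtain rfl : δ = u := by simpa using hδ
    obtain ⟨f, rfl⟩ : 2 ∣ e := (Nat.Coprime.dvd_of_dvd_mul_left
      (Nat.coprime_two_left.2 ⟨w, hw⟩) ⟨2 * n, by linarith⟩)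
    omega
  · have h : u * e = 2 * n := by rw [hδ, zero_add, pow_one] at he; linarith
    obtain ⟨f, rfl⟩ : 2 ∣ e := (Nat.Coprime.dvd_of_dvd_mul_left
      (Nat.coprime_two_left.2 ⟨w, hw⟩) ⟨n, h⟩)
    omega
  · obtain rfl : n = u * e := by
      rw [hδ, zero_add, one_add_one_eq_two] at he; linarith
    obtain ⟨f, hf⟩ := (Nat.odd_mul.1 hn).2
    omega
  · exfalso
    have : n = 2 * (2 ^ v * u * e) := by
      rw [hδ, pow_succ, pow_succ, pow_succ] at he; linarith
    exact Nat.not_odd_iff_even.2 ⟨_, this.trans (two_mul _)⟩ hn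

end Congruences

lemma dvd_sum_mul_of_forall_dvd {N : ℕ} {m : ℤ} {f : ℕ → ℤ} (r : ℕ → ℤ)
    (h : ∀ δ ∈ N.divisors, m ∣ f δ) : m ∣ ∑ δ ∈ N.divisors, f δ * r δ :=
  Finset.dvd_sum fun δ hδ ↦ (h δ hδ).mul_right _

/-- Under the congruences for `∑ δ r_δ` and `∑ (N/δ) r_δ`, the odd parts `u δ` and the `2`-adic
valuations `v δ` of the divisors satisfy the congruences needed to make the Jacobi symbols of
the `η`-multipliers cancel. -/
lemma sum_oddPart_and_sum_valuation {N d : ℕ} {r : ℕ → ℤ} {k : ℤ} {u v : ℕ → ℕ} (hN : 0 < N)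
    (huv : ∀ δ ∈ N.divisors, Odd (u δ) ∧ δ = 2 ^ v δ * u δ)
    (hA : 24 ∣ (N : ℤ) * ∑ δ ∈ N.divisors, (δ : ℤ) * r δ)
    (hB : 24 ∣ ∑ δ ∈ N.divisors, ((N / δ : ℕ) : ℤ) * r δ)
    (hk : 2 * k = ∑ δ ∈ N.divisors, r δ) (hd : Odd d) (hdN : (N : ℤ) ∣ d - 1) :
    8 ∣ (d - 1) * ∑ δ ∈ N.divisors, (u δ : ℤ) * r δ ∧
      (jacobiSym 2 d = 1 ∨ Even (∑ δ ∈ N.divisors, (v δ : ℤ) * r δ)) := by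
  have hmul : ∀ δ ∈ N.divisors, δ * (N / δ) = N := fun δ hδ ↦
    Nat.mul_div_cancel' (Nat.dvd_of_mem_divisors hδ)
  obtain ⟨x, hx⟩ := hd
  obtain ⟨t, n, hn, hNn⟩ := Nat.exists_eq_two_pow_mul_odd hN.ne'
  have hnZ : Odd (n : ℤ) := by exact_mod_cast hn
  set A := ∑ δ ∈ N.divisors, (δ : ℤ) * r δ with hAdef
  set B := ∑ δ ∈ N.divisors, ((N / δ : ℕ) : ℤ) * r δ with hBdef
  set U := ∑ δ ∈ N.divisors, (u δ : ℤ) * r δ with hUdef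
  set V := ∑ δ ∈ N.divisors, (v δ : ℤ) * r δ with hVdef
  have hUk : (2 : ℤ) ∣ U - 2 * k := by
    rw [hk, hUdef, ← Finset.sum_sub_distrib]
    refine Finset.dvd_sum fun δ hδ ↦ ?_
    obtain ⟨w, hw⟩ := (huv δ hδ).1
    exact ⟨w * r δ, by rw [hw]; push_cast; ring⟩
  rcases t with _ | _ | _ | t
  · have hN' : N = n := by simpa using hNn
    have hv : ∀ δ ∈ N.divisors, v δ = 0 := by
      intro δ hδ
      by_contra h
      have : Odd δ := hn.of_dvd_nat (hN' ▸ Nat.dvd_of_mem_divisors hδ)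
      rw [(huv δ hδ).2] at this
      exact Nat.not_even_iff_odd.2 this ((even_two.pow_of_ne_zero h).mul_right _)
    have hU : U = A := Finset.sum_congr rfl fun δ hδ ↦ by
      have := (huv δ hδ).2
      rw [hv δ hδ, pow_zero, one_mul] at this
      rw [← this]
    refine ⟨?_, Or.inr ?_⟩
    · rw [hU]
      have : (2 : ℤ) ^ 3 ∣ A := two_pow_dvd_of_dvd_odd_mul 3 hnZ
        (by rw [← hN']; exact dvd_trans (by norm_num) hA)
      exact Dvd.dvd.mul_left (by simpa using this) _
    · rw [hVdef, Finset.sum_eq_zero fun δ hδ ↦ by rw [hv δ hδ]; simp]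
      exact Even.zero
  · have hN' : N = 2 * n := by simpa using hNn
    have hpt : ∀ δ ∈ N.divisors, (8 : ℤ) ∣ δ + n * (N / δ : ℕ) - 3 * u δ ∧
        (2 : ℤ) ∣ v δ - (N / δ : ℕ) := fun δ hδ ↦
      eight_dvd_of_mul_eq_two_mul hn ((hmul δ hδ).trans hN') (huv δ hδ).1 (huv δ hδ).2
    have h1 : (8 : ℤ) ∣ A + n * B - 3 * U := by
      convert dvd_sum_mul_of_forall_dvd r fun δ hδ ↦ (hpt δ hδ).1 using 1
      simp only [hAdef, hBdef, hUdef, Finset.mul_sum, ← Finset.sum_add_distrib,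
        ← Finset.sum_sub_distrib]
      exact Finset.sum_congr rfl fun δ _ ↦ by ring
    have h2 : (2 : ℤ) ∣ V - B := by
      convert dvd_sum_mul_of_forall_dvd r fun δ hδ ↦ (hpt δ hδ).2 using 1
      simp only [hVdef, hBdef, ← Finset.sum_sub_distrib, sub_mul]
    have h3 : (2 : ℤ) ^ 2 ∣ A := by
      refine two_pow_dvd_of_dvd_odd_mul 2 hnZ ?_
      rw [hN'] at hA
      obtain ⟨m, hm⟩ := hA
      push_cast at hm
      exact ⟨3 * m, by linarith⟩
    have h4 : (8 : ℤ) ∣ n * B := Dvd.dvd.mul_left (dvd_trans (by norm_num) hB) _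
    refine ⟨?_, Or.inr ?_⟩
    · obtain ⟨y, hy⟩ : (4 : ℤ) ∣ U := by omega
      exact ⟨x * y, by rw [hy, hx]; push_cast; ring⟩
    · rw [even_iff_two_dvd]
      omega
  · have hN' : N = 4 * n := by simpa using hNn
    have hd4 : (4 : ℤ) ∣ d - 1 := dvd_trans ⟨n, by rw [hN']; push_cast; ring⟩ hdN
    have h2 : (2 : ℤ) ∣ V + A + B + 2 * k := by
      convert dvd_sum_mul_of_forall_dvd r fun δ hδ ↦
        two_dvd_of_mul_eq_four_mul hn ((hmul δ hδ).trans hN') (huv δ hδ).1 (huv δ hδ).2 using 1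
      simp only [hk, hVdef, hAdef, hBdef, ← Finset.sum_add_distrib]
      exact Finset.sum_congr rfl fun δ _ ↦ by ring
    have h3 : (2 : ℤ) ^ 1 ∣ A := by
      refine two_pow_dvd_of_dvd_odd_mul 1 hnZ ?_
      rw [hN'] at hA
      obtain ⟨m, hm⟩ := hA
      push_cast at hm
      exact ⟨3 * m, by linarith⟩
    refine ⟨?_, Or.inr ?_⟩
    · have : (2 : ℤ) ∣ U := by omega
      exact mul_dvd_mul hd4 this
    · rw [even_iff_two_dvd]
      omega
  · have hd8 : (8 : ℤ) ∣ d - 1 :=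
      dvd_trans ⟨2 ^ t * n, by rw [hNn]; push_cast; ring⟩ hdN
    refine ⟨hd8.mul_right _, Or.inl ?_⟩
    have : d % 8 = 1 := by omega
    rw [jacobiSym.at_two ⟨x, hx⟩, ZMod.χ₈_nat_eq_if_mod_eight]
    simp [this]
    omega

/-! ### Eta products -/

lemma prod_zpow_eq_zpow_sum {ι K : Type*} [Field K] {x : K} (hx : x ≠ 0) (s : Finset ι)
    (f : ι → ℤ) : ∏ i ∈ s, x ^ f i = x ^ ∑ i ∈ s, f i := by
  classical
  induction s using Finset.induction_on with
  | empty => simp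
  | insert a s ha ih => rw [Finset.sum_insert ha, Finset.prod_insert ha, zpow_add₀ hx, ih]

lemma zpow_eq_one_of_even {K : Type*} [Field K] {x : K} (hx : x ^ 2 = 1) {n : ℤ} (hn : Even n) :
    x ^ n = 1 := by
  obtain ⟨m, rfl⟩ := hn
  rw [← two_mul, zpow_mul, zpow_ofNat, hx, one_zpow]

lemma jacobiSym_cast_sq {a : ℤ} {d : ℕ} (h : IsCoprime a d) : (jacobiSym a d : ℂ) ^ 2 = 1 := by
  exact_mod_cast jacobiSym.sq_one (Int.isCoprime_iff_gcd_eq_one.1 h)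

lemma jacobiSym_two_pow_mul {u d : ℕ} (v : ℕ) (hu : Odd u) (hd : Odd d) (h : (u : ℤ) ∣ d - 1) :
    (jacobiSym ((2 ^ v * u : ℕ) : ℤ) d : ℂ) =
      (jacobiSym 2 d : ℂ) ^ v * rootUnity (3 * (u - 1) * (d - 1)) := by
  have h1 : jacobiSym d u = 1 := by
    rw [jacobiSym.mod_left' (Int.modEq_iff_dvd.2 h).symm, jacobiSym.one_left]
  rw [Nat.cast_mul, jacobiSym.mul_left, Nat.cast_pow, jacobiSym.pow_left, Int.cast_mul,
    jacobiSym_reciprocity hu hd, h1]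
  push_cast
  ring

/-- The eta product `∏ η(δ z) ^ r_δ` over the divisors `δ` of `N`. -/
def etaProduct (N : ℕ) (r : ℕ → ℤ) (z : ℂ) : ℂ :=
  ∏ δ ∈ N.divisors, DedekindEta (δ * z) ^ r δ

lemma etaProduct_add_int (N : ℕ) (r : ℕ → ℤ) (z : ℂ) (j : ℤ) :
    etaProduct N r (z + j) =
      rootUnity (j * ∑ δ ∈ N.divisors, (δ : ℤ) * r δ) * etaProduct N r z := by
  rw [etaProduct, etaProduct, Finset.mul_sum, rootUnity_sum, ← Finset.prod_mul_distrib]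
  refine Finset.prod_congr rfl fun δ _ ↦ ?_
  have : (δ : ℂ) * (z + j) = δ * z + (δ * j : ℤ) := by push_cast; ring
  rw [this, dedekindEta_add_int, mul_zpow, rootUnity_zpow]
  ring_nf

lemma dedekindEta_mul_apply {N d δ : ℕ} (hd : Odd d) (hδ : δ ∈ N.divisors) {a b c : ℤ}
    (h : a * d - b * (N * c) = 1) {z : ℂ} (hz : 0 < z.im) :
    DedekindEta (δ * ((a * z + b) / ((N * c : ℤ) * z + d))) =
      jacobiSym (c * (N / δ : ℕ)) d * rootUnity (etaExponent a (b * δ) (c * (N / δ : ℕ)) d) *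
        sqrt ((N * c : ℤ) * z + d) * DedekindEta (δ * z) := by
  have hN : δ * (N / δ) = N := Nat.mul_div_cancel' (Nat.dvd_of_mem_divisors hδ)
  have hNZ : (δ : ℤ) * (N / δ : ℕ) = N := by exact_mod_cast hN
  have hNC : (δ : ℂ) * (N / δ : ℕ) = N := by exact_mod_cast hN
  have hδ0 : 0 < δ := Nat.pos_of_mem_divisors hδ
  have hz' : 0 < ((δ : ℂ) * z).im := by
    rw [← Complex.ofReal_natCast, Complex.im_ofReal_mul]
    positivity
  have key := etaTransforms_of_odd hd (c * (N / δ : ℕ)) a (b * δ)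
    (by linear_combination h - b * c * hNZ) (δ * z) hz'
  have e1 : ((c * (N / δ : ℕ) : ℤ) : ℂ) * (δ * z) + d = (N * c : ℤ) * z + d := by
    simp only [Int.cast_mul, Int.cast_natCast, ← hNC]; ring
  have e2 : (a : ℂ) * (δ * z) + (b * δ : ℤ) = δ * (a * z + b) := by push_cast; ring
  rw [e1, e2, mul_div_assoc] at key
  exact key

lemma etaProduct_apply_of_odd {N d : ℕ} {r : ℕ → ℤ} {k : ℤ} (hN : 0 < N)
    (hA : 24 ∣ (N : ℤ) * ∑ δ ∈ N.divisors, (δ : ℤ) * r δ)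
    (hB : 24 ∣ ∑ δ ∈ N.divisors, ((N / δ : ℕ) : ℤ) * r δ)
    (hk : 2 * k = ∑ δ ∈ N.divisors, r δ) (hd : Odd d) (hdN : (N : ℤ) ∣ d - 1) {a b c : ℤ}
    (h : a * d - b * (N * c) = 1) {z : ℂ} (hz : 0 < z.im) :
    etaProduct N r ((a * z + b) / ((N * c : ℤ) * z + d)) =
      rootUnity (b * ∑ δ ∈ N.divisors, (δ : ℤ) * r δ) * ((N * c : ℤ) * z + d) ^ k *
        etaProduct N r z := by
  have hex (δ : ℕ) : ∃ p : ℕ × ℕ, δ ∈ N.divisors → Odd p.1 ∧ δ = 2 ^ p.2 * p.1 := by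
    by_cases hδ : δ ∈ N.divisors
    · obtain ⟨v, u, hu, e⟩ := Nat.exists_eq_two_pow_mul_odd (Nat.pos_of_mem_divisors hδ).ne'
      exact ⟨(u, v), fun _ ↦ ⟨hu, e⟩⟩
    · exact ⟨0, fun h ↦ absurd h hδ⟩
  choose p hp using hex
  set u : ℕ → ℕ := fun δ ↦ (p δ).1
  set v : ℕ → ℕ := fun δ ↦ (p δ).2
  obtain ⟨hU, hV⟩ := sum_oddPart_and_sum_valuation (u := u) (v := v) hN hp hA hB hk hd hdN
  set A := ∑ δ ∈ N.divisors, (δ : ℤ) * r δ with hAdef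
  set B := ∑ δ ∈ N.divisors, ((N / δ : ℕ) : ℤ) * r δ with hBdef
  set S := sqrt ((N * c : ℤ) * z + d) with hS
  have hS0 : S ≠ 0 := by
    intro h0
    apply mul_add_ne_zero_of_pos (N * c) hd.pos hz
    rw [← sqrt_sq ((N * c : ℤ) * z + d), ← hS, h0]; simp
  have hcop : IsCoprime ((N : ℤ) * c) d := ⟨-b, a, by linear_combination h⟩
  have hJ := jacobiSym_cast_sq hcop
  have hs := jacobiSym_cast_sq (a := 2) (d := d)
    (Int.isCoprime_two_left.2 (by exact_mod_cast hd))
  have hJ0 : (jacobiSym (N * c) d : ℂ) ≠ 0 := fun h0 ↦ by simp [h0] at hJ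
  have hs0 : (jacobiSym 2 d : ℂ) ≠ 0 := fun h0 ↦ by simp [h0] at hs
  have hterm : ∀ δ ∈ N.divisors,
      DedekindEta (δ * ((a * z + b) / ((N * c : ℤ) * z + d))) ^ r δ =
        (jacobiSym (N * c) d : ℂ) ^ r δ * (jacobiSym 2 d : ℂ) ^ ((v δ : ℤ) * r δ) *
          rootUnity ((3 * (u δ - 1) * (d - 1) + etaExponent a (b * δ) (c * (N / δ : ℕ)) d) * r δ) *
          S ^ r δ * DedekindEta (δ * z) ^ r δ := by
    intro δ hδ
    have hN' : (δ : ℤ) * (N / δ : ℕ) = N := by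
      exact_mod_cast Nat.mul_div_cancel' (Nat.dvd_of_mem_divisors hδ)
    have hδd : IsCoprime (δ : ℤ) d :=
      hcop.of_isCoprime_of_dvd_left ⟨(N / δ : ℕ) * c, by rw [← hN']; ring⟩
    have hud : (u δ : ℤ) ∣ d - 1 :=
      dvd_trans ⟨2 ^ v δ * (N / δ : ℕ), by
        rw [← hN']; nth_rewrite 1 [(hp δ hδ).2]; push_cast; ring⟩ hdN
    have h2 := jacobiSym_two_pow_mul (v δ) (hp δ hδ).1 hd hud
    rw [← (hp δ hδ).2] at h2
    have h3 : (jacobiSym (N * c) d : ℂ) =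
        jacobiSym (c * (N / δ : ℕ)) d * jacobiSym δ d := by
      rw [← Int.cast_mul, ← jacobiSym.mul_left, ← hN']
      ring_nf
    have h4 : (jacobiSym (c * (N / δ : ℕ)) d : ℂ) = jacobiSym (N * c) d *
        ((jacobiSym 2 d : ℂ) ^ v δ * rootUnity (3 * (u δ - 1) * (d - 1))) := by
      rw [← h2, h3, mul_assoc, ← sq, jacobiSym_cast_sq hδd, mul_one]
    rw [dedekindEta_mul_apply hd hδ h hz, h4, zpow_mul, zpow_natCast, mul_comm _ (r δ),
      ← rootUnity_zpow _ (r δ), rootUnity_add, ← hS]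
    simp only [mul_zpow]
    ring
  have hE : ∑ δ ∈ N.divisors,
      (3 * (u δ - 1) * (d - 1) + etaExponent a (b * δ) (c * (N / δ : ℕ)) d) * r δ =
        3 * ((d - 1) * ∑ δ ∈ N.divisors, (u δ : ℤ) * r δ) +
          c * (a + d - b * (N * c) * d - 3 * d) * B + b * d * A := by
    simp only [hAdef, hBdef, Finset.mul_sum, ← Finset.sum_add_distrib]
    refine Finset.sum_congr rfl fun δ hδ ↦ ?_
    have hN' : (δ : ℤ) * (N / δ : ℕ) = N := by
      exact_mod_cast Nat.mul_div_cancel' (Nat.dvd_of_mem_divisors hδ)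
    rw [etaExponent, ← hN']
    ring
  have h24 : (24 : ℤ) ∣ b * d * A - b * A := by
    obtain ⟨m, hm⟩ := hdN
    exact (hA.mul_left (b * m)).trans (dvd_of_eq (by linear_combination - b * A * hm))
  have hroot : rootUnity (∑ δ ∈ N.divisors,
      (3 * (u δ - 1) * (d - 1) + etaExponent a (b * δ) (c * (N / δ : ℕ)) d) * r δ) =
        rootUnity (b * A) := by
    rw [hE]
    refine rootUnity_congr ?_
    have h1 := hB.mul_left (c * (a + d - b * (N * c) * d - 3 * d))
    omega
  have hsV : (jacobiSym 2 d : ℂ) ^ (∑ δ ∈ N.divisors, (v δ : ℤ) * r δ) = 1 := by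
    rcases hV with hV | hV
    · rw [hV, Int.cast_one, one_zpow]
    · exact zpow_eq_one_of_even hs hV
  rw [etaProduct, Finset.prod_congr rfl hterm]
  simp only [Finset.prod_mul_distrib]
  rw [prod_zpow_eq_zpow_sum hJ0, prod_zpow_eq_zpow_sum hs0, prod_zpow_eq_zpow_sum hS0,
    ← rootUnity_sum, hroot, hsV, ← hk, zpow_eq_one_of_even hJ (even_two_mul k), zpow_mul S,
    zpow_ofNat, hS, sqrt_sq, etaProduct]
  ring

lemma even_of_dvd_two {N : ℕ} {r : ℕ → ℤ} {k : ℤ} (hN : N ∣ 2)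
    (hA : 24 ∣ (N : ℤ) * ∑ δ ∈ N.divisors, (δ : ℤ) * r δ)
    (hB : 24 ∣ ∑ δ ∈ N.divisors, ((N / δ : ℕ) : ℤ) * r δ)
    (hk : 2 * k = ∑ δ ∈ N.divisors, r δ) : Even k := by
  rw [even_iff_two_dvd]
  rcases (Nat.dvd_prime Nat.prime_two).1 hN with rfl | rfl
  · simp at hA hk
    omega
  · rw [Nat.Prime.divisors Nat.prime_two] at *
    simp at hA hB hk
    omega

lemma exists_odd_pos_add_mul {c d : ℤ} (h : IsCoprime c d) (hc : c ≠ 0) :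
    ∃ (j : ℤ) (D : ℕ), Odd D ∧ (D : ℤ) = d + j * c := by
  obtain ⟨j, hj⟩ : ∃ j : ℤ, Odd (d + j * c) := by
    rcases Int.even_or_odd d with hd | hd
    · have hc' : Odd c := by
        by_contra h'
        rw [Int.not_odd_iff_even, even_iff_two_dvd] at h'
        have := h.isUnit_of_dvd' h' hd.two_dvd
        exact absurd this (by decide)
      exact ⟨1, by simpa using hd.add_odd hc'⟩
    · exact ⟨0, by simpa using hd⟩
  set x := d + j * c with hx
  refine ⟨j + 2 * |x| * c, (x + 2 * |x| * c ^ 2).toNat, ?_, ?_⟩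
  all_goals
    have hc2 : 0 < c ^ 2 := by positivity
    have h0 : 0 ≤ x + 2 * |x| * c ^ 2 := by
      nlinarith [neg_abs_le x, abs_nonneg x]
  · rw [← Int.odd_coe_nat, Int.toNat_of_nonneg h0, mul_assoc]
    exact hj.add_even (even_two_mul _)
  · rw [Int.toNat_of_nonneg h0, hx]
    ring

lemma etaProduct_apply {N : ℕ} {r : ℕ → ℤ} {k : ℤ} (hN : 0 < N)
    (hA : 24 ∣ (N : ℤ) * ∑ δ ∈ N.divisors, (δ : ℤ) * r δ)
    (hB : 24 ∣ ∑ δ ∈ N.divisors, ((N / δ : ℕ) : ℤ) * r δ)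
    (hk : 2 * k = ∑ δ ∈ N.divisors, r δ) {a b c d : ℤ} (h : a * d - b * c = 1)
    (ha : (N : ℤ) ∣ a - 1) (hc : (N : ℤ) ∣ c) (hd : (N : ℤ) ∣ d - 1) {z : ℂ} (hz : 0 < z.im) :
    etaProduct N r ((a * z + b) / (c * z + d)) =
      rootUnity (b * ∑ δ ∈ N.divisors, (δ : ℤ) * r δ) * (c * z + d) ^ k * etaProduct N r z := by
  set A := ∑ δ ∈ N.divisors, (δ : ℤ) * r δ with hAdef
  rcases eq_or_ne c 0 with rfl | hc0
  · rcases Int.mul_eq_one_iff_eq_one_or_neg_one.1 (show a * d = 1 by linarith) with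
      ⟨rfl, rfl⟩ | ⟨rfl, rfl⟩
    · simp [etaProduct_add_int, hAdef]
    · have hN2 : (N : ℤ) ∣ 2 := by simpa using ha.neg_right
      have hke := even_of_dvd_two (by exact_mod_cast hN2) hA hB hk
      have e : ((-1 : ℤ) * z + b) / ((0 : ℤ) * z + (-1 : ℤ)) = z + (-b : ℤ) := by
        push_cast; ring
      rw [e, etaProduct_add_int]
      have e2 : (((0 : ℤ) : ℂ) * z + (-1 : ℤ)) ^ k = 1 := by simp [hke.neg_one_zpow]
      rw [e2, mul_one, ← hAdef]
      congr 1
      refine rootUnity_congr ?_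
      obtain ⟨m, hm⟩ := hN2
      exact (hA.mul_left (-b * m)).trans (dvd_of_eq (by linear_combination b * A * hm))
  · obtain ⟨j, D, hD, hDeq⟩ :=
      exists_odd_pos_add_mul (⟨-b, a, by linear_combination h⟩ : IsCoprime c d) hc0
    obtain ⟨c, rfl⟩ := hc
    have hw : 0 < (z + (-j : ℤ)).im := by simpa using hz
    have key := etaProduct_apply_of_odd (b := b + j * a) hN hA hB hk hD
      (by rw [hDeq, add_sub_right_comm]; exact dvd_add hd ⟨j * c, by ring⟩)
      (show a * D - (b + j * a) * (N * c) = 1 by rw [hDeq]; linear_combination h) hw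
    have hDC : (D : ℂ) = d + j * (N * c : ℤ) := by exact_mod_cast congrArg (Int.cast (R := ℂ)) hDeq
    have e1 : (a : ℂ) * (z + (-j : ℤ)) + (b + j * a : ℤ) = a * z + b := by push_cast; ring
    have e2 : ((N * c : ℤ) : ℂ) * (z + (-j : ℤ)) + D = (N * c : ℤ) * z + d := by
      rw [hDC]; push_cast; ring
    rw [e1, e2, etaProduct_add_int, ← hAdef] at key
    have h24 : (24 : ℤ) ∣ (b + j * a) * A + -j * A - b * A := by
      obtain ⟨m, hm⟩ := ha
      exact (hA.mul_left (j * m)).trans (dvd_of_eq (by linear_combination -j * A * hm))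
    rw [key, ← rootUnity_congr h24, rootUnity_add]
    ring

/-- Proposition: eta products are modular forms for `Γ₁(N)` with the stated
character and weight `k = (1/2) ∑ r_δ`. -/
theorem etaProduct_modular (N : ℕ) (hN : 0 < N) (r : ℕ → ℤ)
    (h1 : ∃ m : ℤ, (N : ℤ) * ∑ δ ∈ N.divisors, (δ : ℤ) * r δ = 24 * m)
    (h2 : ∃ m : ℤ, (N : ℚ) * ∑ δ ∈ N.divisors, (r δ : ℚ) / (δ : ℚ) = 24 * m)
    (k : ℤ) (hk : 2 * k = ∑ δ ∈ N.divisors, r δ)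
    (M : SL(2, ℤ)) (hM : M ∈ Gamma1 N) (τ : ℍ) :
    ∏ δ ∈ N.divisors,
        DedekindEta ((δ : ℂ) *
          (((M.1 0 0 : ℂ) * τ + (M.1 0 1 : ℂ)) / ((M.1 1 0 : ℂ) * τ + (M.1 1 1 : ℂ)))) ^ r δ
      = eFun ((M.1 0 1 : ℂ) * ((∑ δ ∈ N.divisors, (δ : ℤ) * r δ : ℤ) : ℂ) / 24) *
          ((M.1 1 0 : ℂ) * τ + (M.1 1 1 : ℂ)) ^ k *
          ∏ δ ∈ N.divisors, DedekindEta ((δ : ℂ) * τ) ^ r δ := by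
  have hA : 24 ∣ (N : ℤ) * ∑ δ ∈ N.divisors, (δ : ℤ) * r δ := h1
  have hB : 24 ∣ ∑ δ ∈ N.divisors, ((N / δ : ℕ) : ℤ) * r δ := by
    obtain ⟨m, hm⟩ := h2
    refine ⟨m, ?_⟩
    rw [← Int.cast_inj (α := ℚ), Int.cast_mul, Int.cast_ofNat, ← hm, Finset.mul_sum,
      Int.cast_sum]
    refine Finset.sum_congr rfl fun δ hδ ↦ ?_
    rw [Int.cast_mul, Int.cast_natCast, Nat.cast_div (Nat.dvd_of_mem_divisors hδ)
      (by exact_mod_cast (Nat.pos_of_mem_divisors hδ).ne')]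
    ring
  obtain ⟨ha, hd, hc⟩ := (Gamma1_mem N M).1 hM
  have hdet := M.2
  rw [Matrix.det_fin_two] at hdet
  have hdvd {x : ℤ} (hx : (x : ZMod N) = 1) : (N : ℤ) ∣ x - 1 :=
    (ZMod.intCast_zmod_eq_zero_iff_dvd _ N).1 (by simp [hx])
  have key := etaProduct_apply hN hA hB hk hdet (hdvd ha)
    ((ZMod.intCast_zmod_eq_zero_iff_dvd _ N).1 hc) (hdvd hd) τ.im_pos
  rw [rootUnity, Int.cast_mul] at key
  exact key
end
end

section
/- For every positive integer N, the group Γ₁(N) is generated by the set of its elements ((a,b),(c,d)) satisfying c > 0, d > 0 and d ≡ 1 mod 4. -/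
open CongruenceSubgroup
open scoped MatrixGroups

namespace CongruenceSubgroup

/-- The upper unipotent matrix `((1,x),(0,1))`. -/
def upperUnipotent (x : ℤ) : SL(2, ℤ) := ⟨!![1, x; 0, 1], by simp [Matrix.det_fin_two]⟩

/-- The lower unipotent matrix `((1,0),(x,1))`. -/
def lowerUnipotent (x : ℤ) : SL(2, ℤ) := ⟨!![1, 0; x, 1], by simp [Matrix.det_fin_two]⟩

lemma coe_upperUnipotent (x : ℤ) : (upperUnipotent x).1 = !![1, x; 0, 1] := rfl

lemma coe_lowerUnipotent (x : ℤ) : (lowerUnipotent x).1 = !![1, 0; x, 1] := rfl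

/-- The elements `((a,b),(c,d))` of `Γ₁(N)` with `c > 0`, `d > 0` and `d ≡ 1 mod 4`. -/
def positiveGamma1 (N : ℕ) : Set SL(2, ℤ) :=
  {γ | γ ∈ Gamma1 N ∧ 0 < γ.1 1 0 ∧ 0 < γ.1 1 1 ∧ γ.1 1 1 ≡ 1 [ZMOD 4]}

lemma upperUnipotent_mem_Gamma1 (N : ℕ) (x : ℤ) : upperUnipotent x ∈ Gamma1 N := by
  simp [coe_upperUnipotent]

lemma lowerUnipotent_mem_Gamma1 (N : ℕ) (k : ℤ) : lowerUnipotent (N * k) ∈ Gamma1 N := by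
  simp [coe_lowerUnipotent]

lemma lowerUnipotent_mem_closure {N : ℕ} (hN : 0 < N) (k : ℤ) :
    lowerUnipotent (N * k) ∈ Subgroup.closure (positiveGamma1 N) := by
  have pos : ∀ k : ℤ, 0 < k →
      lowerUnipotent (N * k) ∈ Subgroup.closure (positiveGamma1 N) := fun k hk ↦ by
    refine Subgroup.subset_closure ⟨lowerUnipotent_mem_Gamma1 N k, ?_⟩
    have : 0 < (N : ℤ) * k := by positivity
    simpa [coe_lowerUnipotent, hN, Int.ModEq] using hk
  rcases lt_trichotomy k 0 with hk | rfl | hk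
  · have h := inv_mem (pos (-k) (by omega))
    convert h using 1
    ext i j
    fin_cases i <;> fin_cases j <;>
      simp [coe_lowerUnipotent, Matrix.SpecialLinearGroup.coe_inv, Matrix.adjugate_fin_two]
  · convert one_mem (Subgroup.closure (positiveGamma1 N)) using 1
    ext i j
    fin_cases i <;> fin_cases j <;> simp [coe_lowerUnipotent]
  · exact pos k hk

lemma upperUnipotent_mem_closure {N : ℕ} (hN : 0 < N) (x : ℤ) :
    upperUnipotent x ∈ Subgroup.closure (positiveGamma1 N) := by
  have hL := lowerUnipotent_mem_closure hN 1
  refine (Subgroup.mul_mem_cancel_right _ hL).1 (Subgroup.subset_closure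
    ⟨mul_mem (upperUnipotent_mem_Gamma1 N x) (lowerUnipotent_mem_Gamma1 N 1), ?_⟩)
  simp [coe_upperUnipotent, coe_lowerUnipotent, Matrix.SpecialLinearGroup.coe_mul, Matrix.mul_apply, Fin.sum_univ_two, hN, Int.ModEq]

lemma mul_upperUnipotent_apply_one_zero (γ : SL(2, ℤ)) (x : ℤ) :
    (γ * upperUnipotent x).1 1 0 = γ.1 1 0 := by
  simp [coe_upperUnipotent, Matrix.SpecialLinearGroup.coe_mul, Matrix.mul_apply, Fin.sum_univ_two]

lemma mul_upperUnipotent_apply_one_one (γ : SL(2, ℤ)) (x : ℤ) :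
    (γ * upperUnipotent x).1 1 1 = γ.1 1 1 + x * γ.1 1 0 := by
  simp [coe_upperUnipotent, Matrix.SpecialLinearGroup.coe_mul, Matrix.mul_apply, Fin.sum_univ_two]
  ring

lemma mul_lowerUnipotent_apply_one_zero (γ : SL(2, ℤ)) (x : ℤ) :
    (γ * lowerUnipotent x).1 1 0 = γ.1 1 0 + x * γ.1 1 1 := by
  simp [coe_lowerUnipotent, Matrix.SpecialLinearGroup.coe_mul, Matrix.mul_apply, Fin.sum_univ_two]
  ring

lemma mul_lowerUnipotent_apply_one_one (γ : SL(2, ℤ)) (x : ℤ) :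
    (γ * lowerUnipotent x).1 1 1 = γ.1 1 1 := by
  simp [coe_lowerUnipotent, Matrix.SpecialLinearGroup.coe_mul, Matrix.mul_apply, Fin.sum_univ_two]

lemma mem_closure_of_modEq_one {N : ℕ} (hN : 0 < N) {γ : SL(2, ℤ)} (hγ : γ ∈ Gamma1 N)
    (h : γ.1 1 1 ≡ 1 [ZMOD 4]) : γ ∈ Subgroup.closure (positiveGamma1 N) := by
  have hd : γ.1 1 1 ≠ 0 := fun h0 ↦ by rw [h0] at h; revert h; decide
  set c := γ.1 1 0 with hc
  set d := γ.1 1 1 with hd'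
  have hN' : (1 : ℤ) ≤ N := by exact_mod_cast hN
  have hdd : 1 ≤ d * d := by have := mul_self_pos.2 hd; omega
  set c' := c + N * (d * (|c| + 1)) * d with hc'
  have hcpos : 0 < c' := by
    have h1 : 1 ≤ N * (d * d) := by nlinarith
    have h2 : -|c| ≤ c := neg_abs_le c
    have h3 : 0 ≤ |c| := abs_nonneg c
    have h4 : c' = c + N * (d * d) * (|c| + 1) := by rw [hc']; ring
    nlinarith
  rw [← Subgroup.mul_mem_cancel_right _ (lowerUnipotent_mem_closure hN (d * (|c| + 1))),
    ← Subgroup.mul_mem_cancel_right _ (upperUnipotent_mem_closure hN (4 * (|d| + 1)))]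
  refine Subgroup.subset_closure ⟨mul_mem (mul_mem hγ (lowerUnipotent_mem_Gamma1 N _))
    (upperUnipotent_mem_Gamma1 N _), ?_⟩
  rw [mul_upperUnipotent_apply_one_zero, mul_upperUnipotent_apply_one_one,
    mul_lowerUnipotent_apply_one_zero, mul_lowerUnipotent_apply_one_one, ← hc, ← hd', ← hc']
  refine ⟨hcpos, ?_, ?_⟩
  · have h2 : -|d| ≤ d := neg_abs_le d
    have h3 : 0 ≤ |d| := abs_nonneg d
    nlinarith
  · rw [mul_assoc]
    exact (Int.modEq_add_fac_self).trans h

lemma exists_unipotent_shift_eq_one_zmod_four (a b n c d : ZMod 4)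
    (h : a * (1 + n * d) - b * (n * c) = 1) :
    ∃ k j : ZMod 4, 1 + n * d + j * (n * c + n * k * (1 + n * d)) = 1 := by
  revert a b n c d
  decide

end CongruenceSubgroup

/-- `Γ₁(N)` is generated by its elements `((a,b),(c,d))` with `c > 0`, `d > 0`
and `d ≡ 1 mod 4`. -/
theorem gamma1_generated_by (N : ℕ) (hN : 0 < N) :
    Subgroup.closure {γ : SL(2, ℤ) | γ ∈ Gamma1 N ∧ 0 < γ.1 1 0 ∧ 0 < γ.1 1 1 ∧
      γ.1 1 1 ≡ 1 [ZMOD 4]} = Gamma1 N := by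
  refine le_antisymm ((Subgroup.closure_le _).2 fun γ hγ ↦ hγ.1) fun γ hγ ↦ ?_
  change γ ∈ Subgroup.closure (positiveGamma1 N)
  obtain ⟨-, hd, hc⟩ := (Gamma1_mem N γ).1 hγ
  obtain ⟨c, hc⟩ := (ZMod.intCast_zmod_eq_zero_iff_dvd _ _).1 hc
  obtain ⟨d, hd⟩ := (ZMod.intCast_eq_intCast_iff_dvd_sub 1 _ N).1 (by simpa using hd.symm)
  have hc' : γ.1 1 0 = N * c := hc
  have hd' : γ.1 1 1 = 1 + N * d := by rw [← hd]; ring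
  have hdet := γ.2
  rw [Matrix.det_fin_two, hc', hd'] at hdet
  obtain ⟨k, j, hkj⟩ := exists_unipotent_shift_eq_one_zmod_four (γ.1 0 0 : ℤ) (γ.1 0 1 : ℤ)
    (N : ℤ) c d (by exact_mod_cast congrArg (Int.cast : ℤ → ZMod 4) hdet)
  obtain ⟨k, rfl⟩ := ZMod.intCast_surjective k
  obtain ⟨j, rfl⟩ := ZMod.intCast_surjective j
  rw [← Subgroup.mul_mem_cancel_right _ (lowerUnipotent_mem_closure hN k),
    ← Subgroup.mul_mem_cancel_right _ (upperUnipotent_mem_closure hN j)]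
  refine mem_closure_of_modEq_one hN (mul_mem (mul_mem hγ (lowerUnipotent_mem_Gamma1 N _))
    (upperUnipotent_mem_Gamma1 N _)) ?_
  rw [mul_upperUnipotent_apply_one_one, mul_lowerUnipotent_apply_one_zero,
    mul_lowerUnipotent_apply_one_one, hc', hd']
  exact (ZMod.intCast_eq_intCast_iff _ _ 4).1 (by exact_mod_cast hkj)
end

section
/- Let m be a positive integer with m ≡ 1 mod 3. Then ∑_{d∣m} χ₃(m/d)·d² ≥ m²·(2 − π²/6); in particular −36·∑_{d∣m} χ₃(m/d)·d² < −12. -/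
/-- The quadratic character mod 3 (Legendre symbol `(d/3)`). -/
def chi3 (d : ℕ) : ℤ := if d % 3 = 1 then 1 else if d % 3 = 2 then -1 else 0

theorem neg_one_le_chi3 (d : ℕ) : -1 ≤ chi3 d := by
  unfold chi3
  split_ifs <;> norm_num

theorem sum_chi3_div_mul_sq (m : ℕ) :
    ∑ d ∈ m.divisors, (chi3 (m / d) : ℝ) * (d : ℝ) ^ 2 =
      (m : ℝ) ^ 2 * ∑ d ∈ m.divisors, (chi3 d : ℝ) * (1 / (d : ℝ) ^ 2) := by
  rw [← Nat.sum_div_divisors m (fun d => (chi3 d : ℝ) * (1 / (d : ℝ) ^ 2)), Finset.mul_sum]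
  refine Finset.sum_congr rfl fun d hd => ?_
  obtain ⟨hdvd, hm⟩ := Nat.mem_divisors.mp hd
  have hd0 : (d : ℝ) ≠ 0 := Nat.cast_ne_zero.mpr (ne_zero_of_dvd_ne_zero hm hdvd)
  have hm0 : (m : ℝ) ≠ 0 := Nat.cast_ne_zero.mpr hm
  rw [Nat.cast_div hdvd hd0]
  field_simp

theorem two_sub_zeta_two_le_sum_chi3 {m : ℕ} (hm : m ≠ 0) :
    2 - Real.pi ^ 2 / 6 ≤ ∑ d ∈ m.divisors, (chi3 d : ℝ) * (1 / (d : ℝ) ^ 2) := by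
  have hzeta : ∑ d ∈ m.divisors, 1 / (d : ℝ) ^ 2 ≤ Real.pi ^ 2 / 6 :=
    sum_le_hasSum _ (fun _ _ => by positivity) hasSum_zeta_two
  have hone : ∑ d ∈ m.divisors, (if d = 1 then (2 : ℝ) else 0) = 2 := by
    simp [hm]
  calc 2 - Real.pi ^ 2 / 6
      ≤ ∑ d ∈ m.divisors, ((if d = 1 then (2 : ℝ) else 0) - 1 / (d : ℝ) ^ 2) := by
        rw [Finset.sum_sub_distrib, hone]
        linarith
    _ ≤ _ := by
        refine Finset.sum_le_sum fun d _ => ?_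
        split_ifs with hd
        · subst hd
          norm_num [chi3]
        · have hchi : (-1 : ℝ) ≤ chi3 d := by exact_mod_cast neg_one_le_chi3 d
          have hpos : 0 ≤ 1 / (d : ℝ) ^ 2 := by positivity
          nlinarith

/-- For `m ≡ 1 mod 3`: `∑_{d∣m} χ₃(m/d) d² ≥ m²(2 - π²/6)`, hence
`-36 ∑_{d∣m} χ₃(m/d) d² < -12`. -/
theorem chi3_divisor_sum_estimate_one_mod_three (m : ℕ) (hm : 0 < m) (h : m % 3 = 1) :
    (m : ℝ) ^ 2 * (2 - Real.pi ^ 2 / 6) ≤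
        ∑ d ∈ m.divisors, (chi3 (m / d) : ℝ) * (d : ℝ) ^ 2 ∧
      -36 * ∑ d ∈ m.divisors, (chi3 (m / d) : ℝ) * (d : ℝ) ^ 2 < -12 := by
  have hbound : (m : ℝ) ^ 2 * (2 - Real.pi ^ 2 / 6) ≤
      ∑ d ∈ m.divisors, (chi3 (m / d) : ℝ) * (d : ℝ) ^ 2 := by
    rw [sum_chi3_div_mul_sq]
    exact mul_le_mul_of_nonneg_left (two_sub_zeta_two_le_sum_chi3 hm.ne') (sq_nonneg _)
  refine ⟨hbound, ?_⟩
  have hpi : 1 / 3 < 2 - Real.pi ^ 2 / 6 := by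
    nlinarith [Real.pi_lt_d2, Real.pi_pos]
  have hm1 : (1 : ℝ) ≤ (m : ℝ) ^ 2 := one_le_pow₀ (by exact_mod_cast hm)
  nlinarith
end

section
/- Let m be a positive integer with m ≡ 0 mod 3. Then ∑_{d∣m} (χ₃(m/d) + χ₃(d))·d² ≥ m²·(2 − π²/6); in particular −18·∑_{d∣m} (χ₃(m/d) + χ₃(d))·d² < −6. -/
theorem neg_one_le_chi3_div_add_chi3 {m k : ℕ} (h : m % 3 = 0) (hk : k ∣ m) :
    -1 ≤ chi3 (m / k) + chi3 k := by
  obtain ⟨l, rfl⟩ := hk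
  rcases Nat.eq_zero_or_pos k with rfl | hpos
  · simp [chi3]
  rw [Nat.mul_div_cancel_left l hpos]
  have h3 : k % 3 = 0 ∨ l % 3 = 0 := by
    simpa only [← Nat.dvd_iff_mod_eq_zero] using
      Nat.prime_three.dvd_mul.mp (Nat.dvd_of_mod_eq_zero h)
  unfold chi3
  split_ifs <;> omega

theorem sum_divisors_one_div_sq_le (m : ℕ) :
    ∑ k ∈ m.divisors, 1 / (k : ℝ) ^ 2 ≤ Real.pi ^ 2 / 6 :=
  sum_le_hasSum _ (fun _ _ => by positivity) hasSum_zeta_two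

/-- For `m ≡ 0 mod 3`: `∑_{d∣m} (χ₃(m/d)+χ₃(d)) d² ≥ m²(2 - π²/6)`, hence
`-18 ∑_{d∣m} (χ₃(m/d)+χ₃(d)) d² < -6`. -/
theorem chi3_divisor_sum_estimate_zero_mod_three (m : ℕ) (hm : 0 < m) (h : m % 3 = 0) :
    (m : ℝ) ^ 2 * (2 - Real.pi ^ 2 / 6) ≤
        ∑ d ∈ m.divisors, ((chi3 (m / d) : ℝ) + (chi3 d : ℝ)) * (d : ℝ) ^ 2 ∧
      -18 * ∑ d ∈ m.divisors, ((chi3 (m / d) : ℝ) + (chi3 d : ℝ)) * (d : ℝ) ^ 2 < -6 := by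
  have lower : (m : ℝ) ^ 2 * (2 - Real.pi ^ 2 / 6) ≤
      ∑ d ∈ m.divisors, ((chi3 (m / d) : ℝ) + (chi3 d : ℝ)) * (d : ℝ) ^ 2 := by
    rw [← Nat.sum_div_divisors m
      (fun d => ((chi3 (m / d) : ℝ) + (chi3 d : ℝ)) * (d : ℝ) ^ 2)]
    calc (m : ℝ) ^ 2 * (2 - Real.pi ^ 2 / 6)
        ≤ (m : ℝ) ^ 2 * (2 - ∑ k ∈ m.divisors, 1 / (k : ℝ) ^ 2) := by
          gcongr
          exact sum_divisors_one_div_sq_le m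
      _ = ∑ k ∈ m.divisors, (m : ℝ) ^ 2 * ((if k = 1 then 2 else 0) - 1 / (k : ℝ) ^ 2) := by
          rw [← Finset.mul_sum, Finset.sum_sub_distrib, Finset.sum_ite_eq',
            if_pos (Nat.one_mem_divisors.mpr hm.ne')]
      _ ≤ _ := by
          refine Finset.sum_le_sum fun k hk => ?_
          have hkm := Nat.dvd_of_mem_divisors hk
          have hk0 : (k : ℝ) ≠ 0 := by exact_mod_cast (Nat.pos_of_mem_divisors hk).ne'
          rw [Nat.div_div_self hkm hm.ne', Nat.cast_div hkm hk0, div_pow]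
          split_ifs with h1
          · subst h1
            norm_num [chi3, h]
          · have hc : (-1 : ℝ) ≤ chi3 k + chi3 (m / k) := by
              have := neg_one_le_chi3_div_add_chi3 h hkm
              rw [add_comm] at this
              exact_mod_cast this
            calc (m : ℝ) ^ 2 * (0 - 1 / (k : ℝ) ^ 2) = -1 * ((m : ℝ) ^ 2 / (k : ℝ) ^ 2) := by ring
              _ ≤ _ := by gcongr
  refine ⟨lower, ?_⟩
  have hm3 : (3 : ℝ) ≤ m := by exact_mod_cast (by omega : 3 ≤ m)
  have hpi : 1 / 4 ≤ 2 - Real.pi ^ 2 / 6 := by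
    nlinarith [Real.pi_lt_d2, Real.pi_pos]
  nlinarith [mul_le_mul (by nlinarith : (9 : ℝ) ≤ (m : ℝ) ^ 2) hpi (by norm_num) (by positivity)]
end

section
/- Let m be an odd positive integer. Then 54·∑_{d∣m} χ₃(m/d)·d² + 6·∑_{d∣m} χ₃(d)·d² ≥ 54·(2 − π²/6)·m² − 6·(π²/6)·m² > 9·m². -/
theorem abs_chi3_le_one (d : ℕ) : |(chi3 d : ℝ)| ≤ 1 := by
  unfold chi3
  split_ifs <;> norm_num

theorem neg_sq_le_chi3_mul_sq (k d : ℕ) : -(d : ℝ) ^ 2 ≤ (chi3 k : ℝ) * (d : ℝ) ^ 2 := by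
  nlinarith [(abs_le.mp (abs_chi3_le_one k)).1, sq_nonneg (d : ℝ)]

theorem sum_divisors_sq_le (m : ℕ) :
    ∑ d ∈ m.divisors, (d : ℝ) ^ 2 ≤ Real.pi ^ 2 / 6 * (m : ℝ) ^ 2 := by
  have hsum : ∑ d ∈ m.divisors, (d : ℝ) ^ 2 =
      (∑ d ∈ m.divisors, 1 / (d : ℝ) ^ 2) * (m : ℝ) ^ 2 := by
    rw [← Nat.sum_div_divisors m fun d => (d : ℝ) ^ 2, Finset.sum_mul]
    refine Finset.sum_congr rfl fun d hd => ?_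
    have hd0 : (d : ℝ) ≠ 0 := Nat.cast_ne_zero.mpr (Nat.pos_of_mem_divisors hd).ne'
    rw [Nat.cast_div (Nat.dvd_of_mem_divisors hd) hd0]
    ring
  rw [hsum]
  gcongr
  exact sum_le_hasSum _ (fun d _ => by positivity) hasSum_zeta_two

theorem two_mul_sq_sub_le_sum_chi3_div {m : ℕ} (hm : 0 < m) :
    2 * (m : ℝ) ^ 2 - ∑ d ∈ m.divisors, (d : ℝ) ^ 2 ≤
      ∑ d ∈ m.divisors, (chi3 (m / d) : ℝ) * (d : ℝ) ^ 2 := by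
  have hmem : m ∈ m.divisors := Nat.mem_divisors_self m hm.ne'
  rw [← Finset.add_sum_erase _ _ hmem, ← Finset.add_sum_erase _ _ hmem, Nat.div_self hm]
  have hrest : ∑ d ∈ m.divisors.erase m, -(d : ℝ) ^ 2 ≤
      ∑ d ∈ m.divisors.erase m, (chi3 (m / d) : ℝ) * (d : ℝ) ^ 2 :=
    Finset.sum_le_sum fun d _ => neg_sq_le_chi3_mul_sq (m / d) d
  rw [Finset.sum_neg_distrib] at hrest
  have hone : (chi3 1 : ℝ) = 1 := by simp [chi3]
  rw [hone]
  linarith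

theorem neg_sum_sq_le_sum_chi3 (m : ℕ) :
    -∑ d ∈ m.divisors, (d : ℝ) ^ 2 ≤ ∑ d ∈ m.divisors, (chi3 d : ℝ) * (d : ℝ) ^ 2 := by
  rw [← Finset.sum_neg_distrib]
  exact Finset.sum_le_sum fun d _ => neg_sq_le_chi3_mul_sq d d

/-- For odd `m`:
`54 ∑_{d∣m} χ₃(m/d) d² + 6 ∑_{d∣m} χ₃(d) d² ≥ 54(2 - π²/6) m² - 6(π²/6) m² > 9 m²`. -/
theorem chi3_divisor_sum_estimate_odd (m : ℕ) (hm : 0 < m) (hodd : Odd m) :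
    54 * (2 - Real.pi ^ 2 / 6) * (m : ℝ) ^ 2 - 6 * (Real.pi ^ 2 / 6) * (m : ℝ) ^ 2 ≤
        54 * (∑ d ∈ m.divisors, (chi3 (m / d) : ℝ) * (d : ℝ) ^ 2) +
          6 * (∑ d ∈ m.divisors, (chi3 d : ℝ) * (d : ℝ) ^ 2) ∧
      9 * (m : ℝ) ^ 2 <
        54 * (2 - Real.pi ^ 2 / 6) * (m : ℝ) ^ 2 - 6 * (Real.pi ^ 2 / 6) * (m : ℝ) ^ 2 := by
  constructor
  · linarith [sum_divisors_sq_le m, two_mul_sq_sub_le_sum_chi3_div hm, neg_sum_sq_le_sum_chi3 m]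
  · have hpi : Real.pi ^ 2 < 9.9 := by
      nlinarith [Real.pi_lt_d4, Real.pi_pos]
    have hm2 : 0 < (m : ℝ) ^ 2 := by positivity
    nlinarith [mul_pos (sub_pos.mpr hpi) hm2]
end

section
/- Let m be an even positive integer, and for each positive divisor d of m set a_d = −1 if both d and m/d are even, and a_d = 1 otherwise. Then 18·∑_{d∣m} a_d·χ₃(m/d)·d² + 2·∑_{d∣m} a_d·χ₃(d)·d² ≥ 18·(2 − π²/6)·m² − 2·(π²/6)·m² > 3·m². -/
theorem neg_one_le_sign_mul_chi3 {s : ℤ} (hs : s = 1 ∨ s = -1) (n : ℕ) :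
    (-1 : ℝ) ≤ (s : ℝ) * (chi3 n : ℝ) := by
  have h : -1 ≤ s * chi3 n := by
    unfold chi3
    rcases hs with rfl | rfl <;> split_ifs <;> norm_num
  exact_mod_cast h

/-- For even `m`, with `a_d = -1` if both `d` and `m/d` are even and `a_d = 1` otherwise:
`18 ∑_{d∣m} a_d χ₃(m/d) d² + 2 ∑_{d∣m} a_d χ₃(d) d² ≥ 18(2 - π²/6) m² - 2(π²/6) m² > 3 m²`. -/
theorem chi3_divisor_sum_estimate_even (m : ℕ) (hm : 0 < m) (heven : Even m)
    (a : ℕ → ℤ) (ha : ∀ d, a d = if 2 ∣ d ∧ 2 ∣ m / d then -1 else 1) :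
    18 * (2 - Real.pi ^ 2 / 6) * (m : ℝ) ^ 2 - 2 * (Real.pi ^ 2 / 6) * (m : ℝ) ^ 2 ≤
        18 * (∑ d ∈ m.divisors, (a d : ℝ) * (chi3 (m / d) : ℝ) * (d : ℝ) ^ 2) +
          2 * (∑ d ∈ m.divisors, (a d : ℝ) * (chi3 d : ℝ) * (d : ℝ) ^ 2) ∧
      3 * (m : ℝ) ^ 2 <
        18 * (2 - Real.pi ^ 2 / 6) * (m : ℝ) ^ 2 - 2 * (Real.pi ^ 2 / 6) * (m : ℝ) ^ 2 := by
  have hsign (d : ℕ) : a d = 1 ∨ a d = -1 := by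
    rw [ha]
    split_ifs <;> simp
  have hsq := sum_divisors_sq_le m
  have hterm (d n : ℕ) : 0 ≤ (a d : ℝ) * (chi3 n : ℝ) * (d : ℝ) ^ 2 + (d : ℝ) ^ 2 := by
    nlinarith [mul_le_mul_of_nonneg_right (neg_one_le_sign_mul_chi3 (hsign d) n)
      (sq_nonneg (d : ℝ))]
  constructor
  · have hfirst : 2 * (m : ℝ) ^ 2 ≤
        ∑ d ∈ m.divisors, ((a d : ℝ) * (chi3 (m / d) : ℝ) * (d : ℝ) ^ 2 + (d : ℝ) ^ 2) := by
      have ham : a m = 1 := by simp [ha, Nat.div_self hm]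
      have hsingle := Finset.single_le_sum (fun d _ ↦ hterm d (m / d))
        (Nat.mem_divisors_self m hm.ne')
      rw [ham, Nat.div_self hm] at hsingle
      norm_num [chi3] at hsingle ⊢
      linarith
    have hsecond : 0 ≤
        ∑ d ∈ m.divisors, ((a d : ℝ) * (chi3 d : ℝ) * (d : ℝ) ^ 2 + (d : ℝ) ^ 2) :=
      Finset.sum_nonneg fun d _ ↦ hterm d d
    rw [Finset.sum_add_distrib] at hfirst hsecond
    linarith
  · have hpi : Real.pi ^ 2 < 9.9 := by
      nlinarith [Real.pi_lt_d4, Real.pi_pos]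
    have hm2 : (0 : ℝ) < (m : ℝ) ^ 2 := by positivity
    nlinarith [mul_lt_mul_of_pos_right hpi hm2]
end

section
/- Let f(τ) = η(τ)/η(3τ)³ on the upper half-plane ℍ. Then for every matrix M = ((a,b),(c,d)) ∈ Γ₁(3) and every τ ∈ ℍ one has f((aτ+b)/(cτ+d)) = e(−b/3)·(cτ+d)^{−1}·f(τ), i.e. f is a (weakly holomorphic) modular form of weight −1 for Γ₁(3) with character χ(M) = e(−b/3). -/
open Complex UpperHalfPlane CongruenceSubgroup
open scoped MatrixGroups

noncomputable section

lemma eFun_ne_zero (x : ℂ) : eFun x ≠ 0 := Complex.exp_ne_zero _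

lemma dedekindEta_ne_zero {z : ℂ} (hz : 0 < z.im) : DedekindEta z ≠ 0 := by
  rw [dedekindEta_eq_eta]
  exact ModularForm.eta_ne_zero hz

lemma dedekindEta_add_intCast (z : ℂ) (n : ℤ) :
    DedekindEta (z + n) = eFun (n / 24) * DedekindEta z := by
  unfold DedekindEta
  rw [add_div, eFun_add]
  have h (k : ℕ) : eFun ((k + 1) * (z + n)) = eFun ((k + 1) * z) := by
    rw [mul_add, eFun_add]
    have := eFun_intCast ((k + 1) * n)
    push_cast at this
    rw [this, mul_one]
  simp only [h]
  ring

lemma dedekindEta_neg_one_div {z : ℂ} (hz : 0 < z.im) :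
    DedekindEta (-1 / z) = (sqrt Complex.I)⁻¹ * (sqrt z * DedekindEta z) := by
  rw [dedekindEta_eq_eta, dedekindEta_eq_eta]
  simpa using ModularForm.eta_comp_eq_csqrt_I_inv hz

/-- The quotient `η(z)/η(3z)³`. -/
def etaQuotient (z : ℂ) : ℂ := DedekindEta z / DedekindEta (3 * z) ^ 3

/-- The quotient `η(z)/η(z/3)³`, the expansion of `etaQuotient` at the cusp `0`. -/
def etaQuotientDual (z : ℂ) : ℂ := DedekindEta z / DedekindEta (z / 3) ^ 3

lemma eFun_pow (x : ℂ) (n : ℕ) : eFun x ^ n = eFun (n * x) := by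
  rw [eFun, eFun, ← Complex.exp_nat_mul]
  ring_nf

lemma etaQuotient_add_intCast (z : ℂ) (n : ℤ) :
    etaQuotient (z + n) = eFun (-n / 3) * etaQuotient z := by
  have h := dedekindEta_add_intCast (3 * z) (3 * n)
  push_cast at h
  unfold etaQuotient
  rw [mul_add, h, dedekindEta_add_intCast, mul_pow, eFun_pow, mul_div_mul_comm]
  congr 1
  rw [div_eq_iff (eFun_ne_zero _), ← eFun_add]
  push_cast
  ring_nf

lemma etaQuotientDual_add_three_mul_intCast (z : ℂ) (n : ℤ) :
    etaQuotientDual (z + 3 * n) = etaQuotientDual z := by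
  have h := dedekindEta_add_intCast z (3 * n)
  push_cast at h
  have h' : (z + 3 * n) / 3 = z / 3 + n := by ring
  unfold etaQuotientDual
  rw [h', h, dedekindEta_add_intCast, mul_pow, eFun_pow, mul_div_mul_comm]
  have : ((3 : ℕ) : ℂ) * (n / 24) = 3 * n / 24 := by push_cast; ring
  rw [this, div_self (eFun_ne_zero _), one_mul]

lemma etaQuotient_neg_one_div :
    ∃ C : ℂ, ∀ z : ℂ, 0 < z.im → etaQuotient (-1 / z) = C / z * etaQuotientDual z := by
  refine ⟨3 * sqrt 3 * sqrt Complex.I ^ 2, fun z hz => ?_⟩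
  have hz0 : z ≠ 0 := by rintro rfl; simp at hz
  have hw : 0 < (z / 3).im := by
    have : (z / 3).im = z.im / 3 := by simp
    rw [this]
    positivity
  have hw0 : z / 3 ≠ 0 := div_ne_zero hz0 (by norm_num)
  have h3 : 3 * (-1 / z) = -1 / (z / 3) := by field_simp
  have hs : sqrt z = sqrt 3 * sqrt (z / 3) := by
    have hl := Complex.log_ofReal_mul (r := 3) (by norm_num) hw0
    rw [show ((3 : ℝ) : ℂ) * (z / 3) = z by push_cast; ring, Complex.ofReal_log (by norm_num)] at hl
    push_cast at hl
    rw [sqrt_eq_exp hz0, sqrt_eq_exp hw0, sqrt_eq_exp (by norm_num), ← Complex.exp_add, hl, add_div]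
  have hsw : sqrt (z / 3) ≠ 0 := fun h => hw0 (by rw [← sqrt_sq (z / 3), h]; simp)
  have hsI : sqrt Complex.I ≠ 0 := fun h => Complex.I_ne_zero (by rw [← sqrt_sq Complex.I, h]; simp)
  unfold etaQuotient etaQuotientDual
  rw [h3, dedekindEta_neg_one_div hz, dedekindEta_neg_one_div hw, hs]
  have hz3 : z = 3 * sqrt (z / 3) ^ 2 := by rw [sqrt_sq]; ring
  have e := dedekindEta_ne_zero hw
  generalize DedekindEta z = A
  generalize DedekindEta (z / 3) = B at *
  generalize sqrt (z / 3) = r at *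
  subst hz3
  field_simp

lemma neg_one_div_add_three_mul_intCast {z : ℂ} (hz : z ≠ 0) (m : ℤ) :
    -1 / (-1 / z + 3 * ((-m : ℤ) : ℂ)) = z / (3 * m * z + 1) := by
  have hw : -1 / z + 3 * ((-m : ℤ) : ℂ) = -(3 * m * z + 1) / z := by
    push_cast
    field_simp
    ring
  rw [hw, div_div_eq_mul_div, neg_one_mul, neg_div_neg_eq]

lemma linear_ne_zero {z : ℂ} (hz : 0 < z.im) {c d : ℤ} (h : IsCoprime c d) :
    (c : ℂ) * z + d ≠ 0 := by
  intro h0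
  have him := congrArg Complex.im h0
  have hre := congrArg Complex.re h0
  simp [hz.ne'] at him
  subst him
  simp at hre
  subst hre
  exact not_isCoprime_zero_zero h

lemma etaQuotient_div_three_mul_add_one {z : ℂ} (hz : 0 < z.im) (m : ℤ) :
    etaQuotient (z / (3 * m * z + 1)) = (3 * m * z + 1)⁻¹ * etaQuotient z := by
  obtain ⟨C, hC⟩ := etaQuotient_neg_one_div
  have hz0 : z ≠ 0 := by rintro rfl; simp at hz
  have hz' := im_neg_one_div_pos hz
  have hd : 3 * m * z + 1 ≠ 0 := by
    have := linear_ne_zero hz (c := 3 * m) (d := 1) isCoprime_one_right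
    push_cast at this
    exact this
  have hw : -1 / z + 3 * ((-m : ℤ) : ℂ) = -(3 * m * z + 1) / z := by
    push_cast
    field_simp
    ring
  have hwim : 0 < (-1 / z + 3 * ((-m : ℤ) : ℂ)).im := by
    simpa using hz'
  have h1 := hC _ hwim
  have h2 := hC _ hz'
  rw [etaQuotientDual_add_three_mul_intCast, neg_one_div_add_three_mul_intCast hz0, hw] at h1
  have e2 : -1 / (-1 / z) = z := by field_simp
  rw [e2] at h2
  rw [h1, h2]
  field_simp

/-- The transformation law of `etaQuotient` under the matrix `((a, b), (c, d))`. -/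
def EtaQuotientTransforms (a b c d : ℤ) : Prop :=
  ∀ z : ℂ, 0 < z.im → etaQuotient ((a * z + b) / (c * z + d)) =
    eFun (-b / 3) * (c * z + d)⁻¹ * etaQuotient z

lemma EtaQuotientTransforms.of_mul_T_zpow {a b c d : ℤ} (k : ℤ) (ha : 3 ∣ a - 1)
    (h : EtaQuotientTransforms a (b + a * k) c (d + c * k)) : EtaQuotientTransforms a b c d := by
  intro z hz
  obtain ⟨t, ht⟩ := ha
  obtain rfl : a = 3 * t + 1 := by linarith
  have h1 := h (z + (-k : ℤ)) (by simpa using hz)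
  rw [etaQuotient_add_intCast] at h1
  have hn : ((3 * t + 1 : ℤ) : ℂ) * (z + (-k : ℤ)) + (b + (3 * t + 1) * k : ℤ) =
      (3 * t + 1 : ℤ) * z + b := by push_cast; ring
  have hd : (c : ℂ) * (z + (-k : ℤ)) + (d + c * k : ℤ) = c * z + d := by push_cast; ring
  have he : eFun (-(b + (3 * t + 1) * k : ℤ) / 3) * eFun (-(-k : ℤ) / 3) = eFun (-b / 3) := by
    rw [← eFun_add, ← mul_one (eFun (-b / 3)), ← eFun_intCast (-(t * k)), ← eFun_add]
    congr 1
    push_cast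
    ring
  rw [hn, hd] at h1
  rw [h1, ← he]
  ring

lemma EtaQuotientTransforms.of_mul_lower {a b c d : ℤ} (l : ℤ) (hcd : IsCoprime c d)
    (h : EtaQuotientTransforms (a + 3 * l * b) b (c + 3 * l * d) d) :
    EtaQuotientTransforms a b c d := by
  intro z hz
  have hu : 3 * ((-l : ℤ) : ℂ) * z + 1 ≠ 0 := by
    have := linear_ne_zero hz (c := 3 * -l) (d := 1) isCoprime_one_right
    push_cast at this ⊢
    exact this
  have hne := linear_ne_zero hz hcd
  have hw : 0 < (z / (3 * ((-l : ℤ) : ℂ) * z + 1)).im := by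
    rw [← neg_one_div_add_three_mul_intCast (by rintro rfl; simp at hz)]
    exact im_neg_one_div_pos (by simpa using im_neg_one_div_pos hz)
  have h1 := h _ hw
  rw [etaQuotient_div_three_mul_add_one hz] at h1
  have hn : ((a + 3 * l * b : ℤ) : ℂ) * (z / (3 * ((-l : ℤ) : ℂ) * z + 1)) + b =
      (a * z + b) / (3 * ((-l : ℤ) : ℂ) * z + 1) := by
    rw [eq_div_iff hu, add_mul, mul_assoc, div_mul_cancel₀ _ hu]
    push_cast
    ring
  have hd : ((c + 3 * l * d : ℤ) : ℂ) * (z / (3 * ((-l : ℤ) : ℂ) * z + 1)) + d =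
      (c * z + d) / (3 * ((-l : ℤ) : ℂ) * z + 1) := by
    rw [eq_div_iff hu, add_mul, mul_assoc, div_mul_cancel₀ _ hu]
    push_cast
    ring
  rw [hn, hd, div_div_div_cancel_right₀ hu] at h1
  rw [h1, inv_div]
  generalize 3 * ((-l : ℤ) : ℂ) * z + 1 = u at *
  field_simp

lemma exists_two_mul_abs_add_mul_le (x : ℤ) {y : ℤ} (hy : y ≠ 0) :
    ∃ k : ℤ, 2 * |x + y * k| ≤ |y| := by
  refine ⟨-round ((x : ℚ) / y), ?_⟩
  have h := abs_sub_round ((x : ℚ) / y)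
  have hy' : (0 : ℚ) < |(y : ℚ)| := by positivity
  have h2 : |(x : ℚ) + y * (-round ((x : ℚ) / y) : ℤ)| =
      |(y : ℚ)| * |(x : ℚ) / y - round ((x : ℚ) / y)| := by
    rw [← abs_mul]
    congr 1
    push_cast
    field_simp
    ring
  have h3 : 2 * |(x : ℚ) + y * (-round ((x : ℚ) / y) : ℤ)| ≤ |(y : ℚ)| := by
    rw [h2]
    nlinarith
  exact_mod_cast h3

lemma etaQuotientTransforms {a b c d : ℤ} (hdet : a * d - b * c = 1) (ha : 3 ∣ a - 1)
    (hc : 3 ∣ c) (hd : 3 ∣ d - 1) : EtaQuotientTransforms a b c d := by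
  induction hn : c.natAbs using Nat.strong_induction_on generalizing a b c d with
  | _ n ih =>
    by_cases hc0 : c = 0
    · subst hc0
      have had : a * d = 1 := by linarith
      obtain ⟨rfl, rfl⟩ : a = 1 ∧ d = 1 := by
        rcases Int.mul_eq_one_iff_eq_one_or_neg_one.mp had with h | ⟨rfl, rfl⟩
        · exact h
        · omega
      intro z hz
      simpa using etaQuotient_add_intCast z b
    · obtain ⟨k, hk⟩ := exists_two_mul_abs_add_mul_le d hc0
      refine .of_mul_T_zpow k ha ?_
      have hdet' : a * (d + c * k) - (b + a * k) * c = 1 := by linarith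
      have hd' : 3 ∣ d + c * k - 1 := by
        rw [show d + c * k - 1 = d - 1 + c * k by ring]
        exact dvd_add hd (hc.mul_right k)
      generalize d + c * k = d' at *
      generalize b + a * k = b' at *
      have hd0 : d' ≠ 0 := by rintro rfl; omega
      obtain ⟨l, hl⟩ := exists_two_mul_abs_add_mul_le c (y := 3 * d') (by omega)
      refine .of_mul_lower l ⟨-b', a, by linarith⟩ ?_
      have hlt : (c + 3 * l * d').natAbs < n := by
        have e : c + 3 * d' * l = c + 3 * l * d' := by ring
        rw [e] at hl
        have : 0 < |c| := abs_pos.mpr hc0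
        rw [abs_mul] at hl
        norm_num at hl
        zify
        rw [← hn]
        push_cast
        linarith
      refine ih _ hlt (by linear_combination hdet') ?_ ?_ hd' rfl
      · rw [show a + 3 * l * b' - 1 = a - 1 + 3 * (l * b') by ring]
        exact dvd_add ha (Dvd.intro _ rfl)
      · rw [mul_assoc]
        exact dvd_add hc (Dvd.intro _ rfl)

/-- `f(τ) = η(τ)/η(3τ)³` is a weakly holomorphic modular form of weight `-1`
for `Γ₁(3)` with character `χ(M) = e(-b/3)`. -/
theorem eta_quotient_level_three_modular (M : SL(2, ℤ)) (hM : M ∈ Gamma1 3) (τ : ℍ) :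
    (fun z : ℂ => DedekindEta z / DedekindEta (3 * z) ^ 3)
        (((M.1 0 0 : ℂ) * τ + (M.1 0 1 : ℂ)) / ((M.1 1 0 : ℂ) * τ + (M.1 1 1 : ℂ)))
      = eFun (-(M.1 0 1 : ℂ) / 3) * ((M.1 1 0 : ℂ) * τ + (M.1 1 1 : ℂ)) ^ (-1 : ℤ) *
          (DedekindEta τ / DedekindEta (3 * τ) ^ 3) := by
  obtain ⟨ha, hd, hc⟩ := (Gamma1_mem 3 M).mp hM
  have hdet := M.det_coe
  rw [Matrix.det_fin_two] at hdet
  have h := etaQuotientTransforms hdet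
    ((ZMod.intCast_zmod_eq_zero_iff_dvd _ 3).mp (by simpa [sub_eq_zero] using ha))
    ((ZMod.intCast_zmod_eq_zero_iff_dvd _ 3).mp hc)
    ((ZMod.intCast_zmod_eq_zero_iff_dvd _ 3).mp (by simpa [sub_eq_zero] using hd)) τ τ.2
  rw [zpow_neg_one]
  exact h
end
end
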